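/- The function u_0, defined as the pointwise infimum of all non-continuous minimax L_H-supersolutions of (TVP), is a non-continuous minimax L_H-solution of (TVP) and is real-valued, i.e. −∞ < u_0(t,x) < ∞ for all (t,x) ∈ [0,T]×Ω. -/

import Mathlib

open MeasureTheory Set Filter Topology
open scoped InnerProductSpace

noncomputable section

namespace PHJ

/-- The Euclidean state space `ℝ^d`. -/
abbrev E (d : ℕ) := EuclideanSpace ℝ (Fin d)

/-- A path; only its values on `[0, T]` are relevant. -/
abbrev Path (d : ℕ) := ℝ → E d

/-- The set `Ω = D([0,T], ℝ^d)` of paths that are right-continuous on `[0,T)` and have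
left limits on `(0,T]`. -/
def Cadlag (T : ℝ) (d : ℕ) : Set (Path d) :=
  {x | (∀ t ∈ Ico (0 : ℝ) T, ContinuousWithinAt x (Ici t) t) ∧
       (∀ t ∈ Ioc (0 : ℝ) T, ∃ l : E d, Tendsto x (nhdsWithin t (Iio t)) (nhds l))}

/-- The running supremum `sup_{0 ≤ s ≤ t} |x(s)|`. -/
def runSup (d : ℕ) (x : Path d) (t : ℝ) : ℝ :=
  sSup ((fun s => ‖x s‖) '' Icc 0 t)

/-- The supremum distance `sup_{0 ≤ s ≤ T} |x(s) − y(s)|`. -/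
def supDist (T : ℝ) (d : ℕ) (x y : Path d) : ℝ :=
  sSup ((fun s => ‖x s - y s‖) '' Icc 0 T)

/-- The stopped supremum distance `sup_{0 ≤ r ≤ T} |x(r ∧ t) − y(r ∧ s)|`. -/
def stopDist (T : ℝ) (d : ℕ) (t : ℝ) (x : Path d) (s : ℝ) (y : Path d) : ℝ :=
  sSup ((fun r => ‖x (min r t) - y (min r s)‖) '' Icc 0 T)

/-- The pseudometric `d_∞` on `[0,T] × Ω`. -/
def dInf (T : ℝ) (d : ℕ) (p q : ℝ × Path d) : ℝ :=
  |p.1 - q.1| + stopDist T d p.1 p.2 q.1 q.2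

/-- `g` is an integrable a.e.-derivative of `x` on `[s₀, T]` (so that `x` is absolutely
continuous there) satisfying the growth bound `|x′(t)| ≤ L (1 + sup_{s ≤ t} |x(s)|)` a.e. -/
def XDeriv (T : ℝ) (d : ℕ) (L s₀ : ℝ) (x g : Path d) : Prop :=
  IntegrableOn g (Icc s₀ T) volume ∧
  (∀ t ∈ Icc s₀ T, x t = x s₀ + ∫ s in s₀..t, g s) ∧
  (∀ᵐ t ∂(volume.restrict (Ioo s₀ T)), ‖g t‖ ≤ L * (1 + runSup d x t))

/-- The set `X^L(s₀, x₀)` of "Lipschitz-like" paths. -/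
def XSet (T : ℝ) (d : ℕ) (L s₀ : ℝ) (x₀ : Path d) : Set (Path d) :=
  {x | x ∈ Cadlag T d ∧ (∀ t ∈ Icc 0 s₀, x t = x₀ t) ∧ ∃ g, XDeriv T d L s₀ x g}

/-- Type of Hamiltonians `H(t, x, y, z)`. -/
abbrev Ham (d : ℕ) := ℝ → Path d → ℝ → E d → ℝ

/-- The set `Y^L(s₀, x₀, y₀, z)` of characteristic pairs `(x, y)`. -/
def YSet (T : ℝ) (d : ℕ) (H : Ham d) (L s₀ : ℝ) (x₀ : Path d) (y₀ : ℝ) (z : E d) :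
    Set (Path d × (ℝ → ℝ)) :=
  {p | p.1 ∈ Cadlag T d ∧ (∀ t ∈ Icc 0 s₀, p.1 t = x₀ t) ∧
       ContinuousOn p.2 (Icc s₀ T) ∧
       ∃ g, XDeriv T d L s₀ p.1 g ∧
         IntegrableOn (fun s => ⟪g s, z⟫_ℝ - H s p.1 (p.2 s) z) (Icc s₀ T) volume ∧
         ∀ t ∈ Icc s₀ T, p.2 t = y₀ + ∫ s in s₀..t, (⟪g s, z⟫_ℝ - H s p.1 (p.2 s) z)}

/-- Assumption (i): for a.e. `t`, `(x, y, z) ↦ H(t, x, y, z)` is continuous. -/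
def HamCont (T : ℝ) (d : ℕ) (H : Ham d) : Prop :=
  ∀ᵐ t ∂(volume.restrict (Ioo (0 : ℝ) T)),
    ∀ x ∈ Cadlag T d, ∀ (y : ℝ) (z : E d), ∀ ε > (0 : ℝ), ∃ δ > (0 : ℝ),
      ∀ x' ∈ Cadlag T d, ∀ (y' : ℝ) (z' : E d),
        supDist T d x x' < δ → |y - y'| < δ → ‖z - z'‖ < δ →
        |H t x y z - H t x' y' z'| < ε

/-- Assumption (ii): `t ↦ H(t, x, y, z)` is Borel measurable. -/
def HamMeas (d : ℕ) (H : Ham d) : Prop :=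
  ∀ (x : Path d) (y : ℝ) (z : E d), Measurable fun t => H t x y z

/-- Assumption (iii): Lipschitz continuity in `z` with constant `L_H (1 + sup_{s≤t} |x(s)|)`. -/
def HamLipZ (T : ℝ) (d : ℕ) (H : Ham d) (LH : ℝ) : Prop :=
  0 ≤ LH ∧ ∀ᵐ t ∂(volume.restrict (Ioo (0 : ℝ) T)),
    ∀ x ∈ Cadlag T d, ∀ (y : ℝ) (z z' : E d),
      |H t x y z - H t x y z'| ≤ LH * (1 + runSup d x t) * ‖z - z'‖

/-- Assumption (iv): local Lipschitz continuity in `x` along `X^L`-paths,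
with constant `M L`. -/
def HamLipX (T : ℝ) (d : ℕ) (H : Ham d) (M : ℝ → ℝ) : Prop :=
  ∀ L ≥ (0 : ℝ), 0 ≤ M L ∧
    ∀ t₀ ∈ Ico (0 : ℝ) T, ∀ x₀ ∈ Cadlag T d,
      ∀ x ∈ XSet T d L t₀ x₀, ∀ x' ∈ XSet T d L t₀ x₀, ∀ (y : ℝ) (z : E d),
        ∀ᵐ t ∂(volume.restrict (Ioo t₀ T)),
          |H t x y z - H t x' y z| ≤
            M L * (1 + |y| + ‖z‖) * sSup ((fun s => ‖x s - x' s‖) '' Icc 0 t)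

/-- Assumption (v): `y ↦ H(t, x, y, z)` is non-increasing. -/
def HamMono (T : ℝ) (d : ℕ) (H : Ham d) : Prop :=
  ∀ᵐ t ∂(volume.restrict (Ioo (0 : ℝ) T)),
    ∀ x ∈ Cadlag T d, ∀ (z : E d) (y y' : ℝ), y ≤ y' → H t x y' z ≤ H t x y z

/-- Assumption (vi): growth bound `|H(t, x, y, 0)| ≤ C_H (1 + sup_{s≤t}|x(s)| + |y|)`. -/
def HamBound (T : ℝ) (d : ℕ) (H : Ham d) (CH : ℝ) : Prop :=
  0 ≤ CH ∧ ∀ᵐ t ∂(volume.restrict (Ioo (0 : ℝ) T)),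
    ∀ x ∈ Cadlag T d, ∀ y : ℝ, |H t x y 0| ≤ CH * (1 + runSup d x t + |y|)

/-- Lower semicontinuity on `[0,T] × Ω` with respect to `d_∞`. -/
def LscOn (T : ℝ) (d : ℕ) (u : ℝ → Path d → ℝ) : Prop :=
  ∀ t₀ ∈ Icc (0 : ℝ) T, ∀ x₀ ∈ Cadlag T d, ∀ c : ℝ, c < u t₀ x₀ →
    ∃ δ > (0 : ℝ), ∀ t ∈ Icc (0 : ℝ) T, ∀ x ∈ Cadlag T d,
      dInf T d (t₀, x₀) (t, x) < δ → c < u t x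

/-- Upper semicontinuity on `[0,T] × Ω` with respect to `d_∞`. -/
def UscOn (T : ℝ) (d : ℕ) (u : ℝ → Path d → ℝ) : Prop :=
  ∀ t₀ ∈ Icc (0 : ℝ) T, ∀ x₀ ∈ Cadlag T d, ∀ c : ℝ, u t₀ x₀ < c →
    ∃ δ > (0 : ℝ), ∀ t ∈ Icc (0 : ℝ) T, ∀ x ∈ Cadlag T d,
      dInf T d (t₀, x₀) (t, x) < δ → u t x < c

/-- Continuity of the terminal condition `h` with respect to the sup norm. -/
def TermCont (T : ℝ) (d : ℕ) (h : Path d → ℝ) : Prop :=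
  ∀ x ∈ Cadlag T d, ∀ ε > (0 : ℝ), ∃ δ > (0 : ℝ), ∀ x' ∈ Cadlag T d,
    supDist T d x x' < δ → |h x' - h x| < ε

/-- `u` is a minimax `L`-supersolution of the terminal-value problem (TVP). -/
def MinimaxSuper (T : ℝ) (d : ℕ) (H : Ham d) (h : Path d → ℝ) (L : ℝ)
    (u : ℝ → Path d → ℝ) : Prop :=
  LscOn T d u ∧ (∀ x ∈ Cadlag T d, h x ≤ u T x) ∧
  ∀ s₀ ∈ Ico (0 : ℝ) T, ∀ x₀ ∈ Cadlag T d, ∀ (z : E d) (y₀ : ℝ), u s₀ x₀ ≤ y₀ →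
    ∃ p ∈ YSet T d H L s₀ x₀ y₀ z, ∀ t ∈ Icc s₀ T, u t p.1 ≤ p.2 t

/-- `u` is a minimax `L`-subsolution of the terminal-value problem (TVP). -/
def MinimaxSub (T : ℝ) (d : ℕ) (H : Ham d) (h : Path d → ℝ) (L : ℝ)
    (u : ℝ → Path d → ℝ) : Prop :=
  UscOn T d u ∧ (∀ x ∈ Cadlag T d, u T x ≤ h x) ∧
  ∀ s₀ ∈ Ico (0 : ℝ) T, ∀ x₀ ∈ Cadlag T d, ∀ (z : E d) (y₀ : ℝ), y₀ ≤ u s₀ x₀ →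
    ∃ p ∈ YSet T d H L s₀ x₀ y₀ z, ∀ t ∈ Icc s₀ T, p.2 t ≤ u t p.1

/-- `u` is a minimax `L`-solution of the terminal-value problem (TVP). -/
def MinimaxSol (T : ℝ) (d : ℕ) (H : Ham d) (h : Path d → ℝ) (L : ℝ)
    (u : ℝ → Path d → ℝ) : Prop :=
  MinimaxSuper T d H h L u ∧ MinimaxSub T d H h L u

/-- Embedding of a path into the space of functions on `[0,T]` with the topology of
uniform convergence (i.e. the sup-norm topology). -/
def toUnif (T : ℝ) (d : ℕ) (x : Path d) : UniformFun (Icc (0 : ℝ) T) (E d) :=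
  UniformFun.ofFun fun s => x s.1

/-- Embedding of a real-valued function into the space of functions on `[s₀,T]` with the
topology of uniform convergence. -/
def toUnifR (T s₀ : ℝ) (y : ℝ → ℝ) : UniformFun (Icc s₀ T) ℝ :=
  UniformFun.ofFun fun s => y s.1


/-- Continuity on `[0,T] × Ω` with respect to `d_∞`. -/
def Cont2 (T : ℝ) (d : ℕ) (u : ℝ → Path d → ℝ) : Prop :=
  ∀ t₀ ∈ Icc (0 : ℝ) T, ∀ x₀ ∈ Cadlag T d, ∀ ε > (0 : ℝ), ∃ δ > (0 : ℝ),
    ∀ t ∈ Icc (0 : ℝ) T, ∀ x ∈ Cadlag T d,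
      dInf T d (t₀, x₀) (t, x) < δ → |u t x - u t₀ x₀| < ε

/-- `u : [0,T] × Ω → [−∞,∞]` is a non-continuous minimax `L`-supersolution of (TVP). -/
def NCSuper (T : ℝ) (d : ℕ) (H : Ham d) (h : Path d → ℝ) (L : ℝ)
    (u : ℝ → Path d → EReal) : Prop :=
  (∀ x ∈ Cadlag T d, u T x = ((h x : ℝ) : EReal)) ∧
  ∀ t₀ ∈ Ico (0 : ℝ) T, ∀ x₀ ∈ Cadlag T d, ∀ (z : E d) (y₀ : ℝ),
    u t₀ x₀ < ((y₀ : ℝ) : EReal) → ∀ T₀ ∈ Ioc t₀ T,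
      sInf ((fun p : Path d × (ℝ → ℝ) => u T₀ p.1 - ((p.2 T₀ : ℝ) : EReal)) ''
        YSet T d H L t₀ x₀ y₀ z) ≤ 0

/-- `u : [0,T] × Ω → [−∞,∞]` is a non-continuous minimax `L`-subsolution of (TVP). -/
def NCSub (T : ℝ) (d : ℕ) (H : Ham d) (h : Path d → ℝ) (L : ℝ)
    (u : ℝ → Path d → EReal) : Prop :=
  (∀ x ∈ Cadlag T d, u T x = ((h x : ℝ) : EReal)) ∧
  ∀ t₀ ∈ Ico (0 : ℝ) T, ∀ x₀ ∈ Cadlag T d, ∀ (z : E d) (y₀ : ℝ),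
    ((y₀ : ℝ) : EReal) < u t₀ x₀ → ∀ T₀ ∈ Ioc t₀ T,
      0 ≤ sSup ((fun p : Path d × (ℝ → ℝ) => u T₀ p.1 - ((p.2 T₀ : ℝ) : EReal)) ''
        YSet T d H L t₀ x₀ y₀ z)

/-- The function `μ^z_+(t₀, x₀, y₀) = sup{ h(x) − y(T) : (x,y) ∈ Y^{L_H}(t₀,x₀,y₀,z) }`. -/
def muPlus (T : ℝ) (d : ℕ) (H : Ham d) (h : Path d → ℝ) (LH : ℝ) (z : E d)
    (t₀ : ℝ) (x₀ : Path d) (y₀ : ℝ) : EReal :=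
  sSup ((fun p : Path d × (ℝ → ℝ) => ((h p.1 - p.2 T : ℝ) : EReal)) ''
    YSet T d H LH t₀ x₀ y₀ z)

/-- The function `u^z_+` given by `u^z_+(t₀,x₀) = sup{ r ∈ ℝ : μ^z_+(t₀,x₀,r) ≥ 0 }`
(with `sup ∅ = −∞`) for `t₀ < T`, and `u^z_+(T,·) = h`. -/
def uPlus (T : ℝ) (d : ℕ) (H : Ham d) (h : Path d → ℝ) (LH : ℝ) (z : E d)
    (t₀ : ℝ) (x₀ : Path d) : EReal :=
  if t₀ = T then ((h x₀ : ℝ) : EReal)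
  else sSup {v : EReal | ∃ r : ℝ, v = ((r : ℝ) : EReal) ∧ 0 ≤ muPlus T d H h LH z t₀ x₀ r}

/-- The Perron-type function `u₀`, the pointwise infimum of all non-continuous minimax
`L_H`-supersolutions of (TVP). -/
def uZero (T : ℝ) (d : ℕ) (H : Ham d) (h : Path d → ℝ) (LH : ℝ)
    (t : ℝ) (x : Path d) : EReal :=
  sInf {v : EReal | ∃ u : ℝ → Path d → EReal, NCSuper T d H h LH u ∧ v = u t x}

/-- The upper semicontinuous envelope with respect to `d_∞` of an extended-real-valued
function on `[0,T] × Ω`. -/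
def uscEnv (T : ℝ) (d : ℕ) (u : ℝ → Path d → EReal) (t₀ : ℝ) (x₀ : Path d) : EReal :=
  ⨅ δ ∈ Ioi (0 : ℝ),
    sSup {v : EReal | ∃ t ∈ Icc (0 : ℝ) T, ∃ x ∈ Cadlag T d,
      dInf T d (t₀, x₀) (t, x) < δ ∧ v = u t x}

/-- The lower semicontinuous envelope with respect to `d_∞` of an extended-real-valued
function on `[0,T] × Ω`. -/
def lscEnv (T : ℝ) (d : ℕ) (u : ℝ → Path d → EReal) (t₀ : ℝ) (x₀ : Path d) : EReal :=
  ⨆ δ ∈ Ioi (0 : ℝ),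
    sInf {v : EReal | ∃ t ∈ Icc (0 : ℝ) T, ∃ x ∈ Cadlag T d,
      dInf T d (t₀, x₀) (t, x) < δ ∧ v = u t x}

/-! ### A Peano theorem for causal functional differential equations -/

section Peano

lemma exists_subseq_tendstoUniformlyOn {V : Type*} [NormedAddCommGroup V] [ProperSpace V] {a b : ℝ} (hab : a ≤ b) {K : NNReal}
    {R : ℝ} (w : ℕ → ℝ → V) (hw : ∀ n, LipschitzOnWith K (w n) (Icc a b))
    (hR : ∀ n, ‖w n a‖ ≤ R) :
    ∃ φ : ℕ → ℕ, StrictMono φ ∧ ∃ w' : ℝ → V, LipschitzWith K w' ∧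
      TendstoUniformlyOn (fun n => w (φ n)) w' atTop (Icc a b) := by
  have hLip : ∀ n, LipschitzWith K ((Icc a b).domRestrict (w n)) := fun n =>
    lipschitzOnWith_iff_restrict.1 (hw n)
  let f : ℕ → BoundedContinuousFunction (Icc a b) V := fun n =>
    BoundedContinuousFunction.mkOfCompact ⟨_, (hLip n).continuous⟩
  have hf : ∀ n x, f n x = w n x := fun n x => rfl
  have hcomp : IsCompact (closure (range f)) := by
    refine BoundedContinuousFunction.arzela_ascoli (Metric.closedBall 0 (R + K * (b - a)))
      (isCompact_closedBall _ _) _ ?_ ?_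
    · rintro _ x ⟨n, rfl⟩
      rw [mem_closedBall_zero_iff, hf]
      have h1 := (hw n).dist_le_mul x x.2 a (left_mem_Icc.2 hab)
      have h2 : dist (x : ℝ) a ≤ b - a := by
        rw [Real.dist_eq, abs_of_nonneg (by linarith [x.2.1])]; linarith [x.2.2]
      have h3 : ‖w n x‖ ≤ ‖w n a‖ + dist (w n x) (w n a) := by
        rw [dist_eq_norm]; linarith [norm_sub_norm_le (w n x) (w n a)]
      have h4 : (K : ℝ) * dist (x : ℝ) a ≤ K * (b - a) := by gcongr
      linarith [hR n]
    · refine UniformEquicontinuous.equicontinuous ?_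
      refine LipschitzWith.uniformEquicontinuous _ K ?_
      rintro ⟨_, n, rfl⟩
      exact hLip n
  obtain ⟨g, -, φ, hφ, hg⟩ :=
    hcomp.tendsto_subseq (x := f) (fun n => subset_closure (mem_range_self n))
  have hunif := BoundedContinuousFunction.tendsto_iff_tendstoUniformly.1 hg
  have hgL : LipschitzWith K g := by
    refine LipschitzWith.of_dist_le_mul fun x y => ?_
    exact le_of_tendsto ((hunif.tendsto_at x).dist (hunif.tendsto_at y))
      (Eventually.of_forall fun n => (hLip (φ n)).dist_le_mul x y)
  refine ⟨φ, hφ, IccExtend hab g, ?_, ?_⟩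
  · rw [← mul_one K]
    exact hgL.comp (LipschitzWith.projIcc hab)
  · rw [Metric.tendstoUniformlyOn_iff]
    intro ε hε
    filter_upwards [Metric.tendstoUniformly_iff.1 hunif ε hε] with n hn x hx
    rw [IccExtend_of_mem hab g hx]
    exact hn ⟨x, hx⟩

lemma intervalIntegrable_of_bound {V : Type*} [NormedAddCommGroup V] {a b p q K : ℝ} {f : ℝ → V}
    (hf : AEStronglyMeasurable f (volume.restrict (Ioo a b))) (hK : ∀ t, ‖f t‖ ≤ K)
    (hp : p ∈ Icc a b) (hq : q ∈ Icc a b) : IntervalIntegrable f volume p q := by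
  have h1 : IntegrableOn f (Icc a b) := by
    rw [integrableOn_Icc_iff_integrableOn_Ioo]
    exact Integrable.of_bound hf K (Eventually.of_forall hK)
  exact (h1.mono_set (uIcc_subset_Icc hp hq)).intervalIntegrable

variable {V : Type*} [NormedAddCommGroup V] [NormedSpace ℝ V]

/-- Lipschitz curves with initial value `w₀` at time `a`. -/
def Admissible (a : ℝ) (w₀ : V) (w : ℝ → V) : Prop :=
  (∃ K : NNReal, LipschitzWith K w) ∧ w a = w₀

/-- Carathéodory conditions for the causal functional differential equation `w' = F(t, w)`
with initial value `w₀` at time `a`. -/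
structure IsCaratheodory (a b : ℝ) (w₀ : V) (F : ℝ → (ℝ → V) → V) : Prop where
  meas : ∀ w, Admissible a w₀ w →
    AEStronglyMeasurable (fun t => F t w) (volume.restrict (Ioo a b))
  causal : ∀ w w', Admissible a w₀ w → Admissible a w₀ w' → ∀ c ∈ Icc a b,
    EqOn w w' (Icc a c) → ∀ᵐ t ∂(volume.restrict (Ioo a c)), F t w = F t w'
  cont : ∀ᵐ t ∂(volume.restrict (Ioo a b)), ∀ (w : ℕ → ℝ → V) (w' : ℝ → V),
    (∀ n, Admissible a w₀ (w n)) → Admissible a w₀ w' →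
    TendstoUniformlyOn w w' atTop (Icc a b) →
    Tendsto (fun n => F t (w n)) atTop (𝓝 (F t w'))

/-- The Tonelli delay operator. -/
def delayMap (a b : ℝ) (w₀ : V) (F : ℝ → (ℝ → V) → V) (δ : ℝ) (w : ℝ → V) (t : ℝ) : V :=
  w₀ + ∫ s in a..max a (min b (t - δ)), F s w

lemma delayMap_self {a b : ℝ} (w₀ : V) (F : ℝ → (ℝ → V) → V) {δ : ℝ}
    (hδ : 0 ≤ δ) (w : ℝ → V) : delayMap a b w₀ F δ w a = w₀ := by
  have : max a (min b (a - δ)) = a := max_eq_left (min_le_of_right_le (by linarith))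
  simp [delayMap, this]

lemma delayMap_lipschitz {a b : ℝ} (hab : a ≤ b) {w₀ : V} {F : ℝ → (ℝ → V) → V}
    (hF : IsCaratheodory a b w₀ F) {K : NNReal} (hK : ∀ t w, ‖F t w‖ ≤ K) (δ : ℝ) {w : ℝ → V}
    (hw : Admissible a w₀ w) : LipschitzWith K (delayMap a b w₀ F δ w) := by
  refine LipschitzWith.of_dist_le_mul fun t t' => ?_
  have hm : ∀ t, max a (min b (t - δ)) ∈ Icc a b := fun t =>
    ⟨le_max_left _ _, max_le hab (min_le_left _ _)⟩
  have ha : a ∈ Icc a b := left_mem_Icc.2 hab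
  rw [dist_eq_norm, delayMap, delayMap, add_sub_add_left_eq_sub,
    intervalIntegral.integral_interval_sub_left
      (intervalIntegrable_of_bound (hF.meas w hw) (fun s => hK s w) ha (hm t))
      (intervalIntegrable_of_bound (hF.meas w hw) (fun s => hK s w) ha (hm t'))]
  refine (intervalIntegral.norm_integral_le_of_norm_le_const fun s _ => hK s w).trans ?_
  gcongr
  rw [Real.dist_eq]
  have h1 := abs_max_sub_max_le_max a (min b (t - δ)) a (min b (t' - δ))
  have h2 := abs_min_sub_min_le_max b (t - δ) b (t' - δ)
  rw [sub_self, abs_zero, max_eq_right (a := (0 : ℝ)) (abs_nonneg _)] at h1 h2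
  rw [sub_sub_sub_cancel_right] at h2
  exact h1.trans h2

lemma exists_delayed {a b : ℝ} (hab : a ≤ b) {w₀ : V} {F : ℝ → (ℝ → V) → V}
    (hF : IsCaratheodory a b w₀ F) {K : NNReal} (hK : ∀ t w, ‖F t w‖ ≤ K) {δ : ℝ} (hδ : 0 < δ) :
    ∃ w, LipschitzWith K w ∧ w a = w₀ ∧
      ∀ t ∈ Icc a b, w t = w₀ + ∫ s in a..max a (t - δ), F s w := by
  let W : ℕ → ℝ → V := fun n => (delayMap a b w₀ F δ)^[n] fun _ => w₀
  have hWs : ∀ n, W (n + 1) = delayMap a b w₀ F δ (W n) := fun n =>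
    Function.iterate_succ_apply' _ _ _
  have hW : ∀ n, LipschitzWith K (W n) ∧ W n a = w₀ := by
    intro n
    induction n with
    | zero => exact ⟨LipschitzWith.const' _ , rfl⟩
    | succ n ih =>
      rw [hWs]
      exact ⟨delayMap_lipschitz hab hF hK δ ⟨⟨K, ih.1⟩, ih.2⟩, delayMap_self _ _ hδ.le _⟩
  have hadm : ∀ n, Admissible a w₀ (W n) := fun n => ⟨⟨K, (hW n).1⟩, (hW n).2⟩
  have hstep : ∀ n : ℕ, ∀ t ∈ Icc a b, t ≤ a + n * δ → W (n + 1) t = W n t := by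
    intro n
    induction n with
    | zero =>
      intro t ht h
      have : t = a := le_antisymm (by simpa using h) ht.1
      rw [this, (hW _).2, (hW _).2]
    | succ n ih =>
      intro t ht h
      rw [hWs (n + 1), hWs n, delayMap, delayMap]
      congr 1
      set c := max a (min b (t - δ)) with hc
      have hca : a ≤ c := le_max_left _ _
      have hcb : c ≤ b := max_le hab (min_le_left _ _)
      have hcn : c ≤ a + n * δ := by
        refine max_le (by nlinarith [Nat.cast_nonneg (α := ℝ) n]) (min_le_of_right_le ?_)
        push_cast at h; linarith
      rw [intervalIntegral.integral_of_le hca, intervalIntegral.integral_of_le hca,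
        integral_Ioc_eq_integral_Ioo, integral_Ioc_eq_integral_Ioo]
      rw [← hWs n]
      refine integral_congr_ae (hF.causal _ _ (hadm _) (hadm _) c ⟨hca, hcb⟩ fun s hs => ?_)
      exact ih s ⟨hs.1, hs.2.trans hcb⟩ (hs.2.trans hcn)
  obtain ⟨N, hN⟩ := exists_nat_ge ((b - a) / δ)
  refine ⟨W N, (hW N).1, (hW N).2, fun t ht => ?_⟩
  have hN' : b - a ≤ N * δ := (div_le_iff₀ hδ).1 hN
  rw [← hstep N t ht (by linarith [ht.2]), hWs, delayMap, min_eq_right (by linarith [ht.2])]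

lemma exists_solution_of_bounded [FiniteDimensional ℝ V] {a b : ℝ} (hab : a ≤ b) {w₀ : V}
    {F : ℝ → (ℝ → V) → V} (hF : IsCaratheodory a b w₀ F) {K : NNReal}
    (hK : ∀ t w, ‖F t w‖ ≤ K) :
    ∃ w, LipschitzWith K w ∧ ∀ t ∈ Icc a b, w t = w₀ + ∫ s in a..t, F s w := by
  have : ProperSpace V := FiniteDimensional.proper ℝ V
  choose w hwL hwa hw using fun n : ℕ =>
    exists_delayed hab hF hK (δ := 1 / ((n : ℝ) + 1)) Nat.one_div_pos_of_nat
  obtain ⟨φ, hφ, w', hw'L, hlim⟩ := exists_subseq_tendstoUniformlyOn (R := ‖w₀‖) hab w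
    (fun n => (hwL n).lipschitzOnWith) (fun n => by rw [hwa])
  have ha : a ∈ Icc a b := left_mem_Icc.2 hab
  have hw'a : w' a = w₀ :=
    tendsto_nhds_unique (hlim.tendsto_at ha) (by simp only [hwa]; exact tendsto_const_nhds)
  have hadm : ∀ n, Admissible a w₀ (w n) := fun n => ⟨⟨K, hwL n⟩, hwa n⟩
  refine ⟨w', hw'L, fun t ht => ?_⟩
  have hint : Tendsto (fun n => ∫ s in a..t, F s (w (φ n))) atTop (𝓝 (∫ s in a..t, F s w')) := by
    have hsub : volume.restrict (uIoc a t) ≤ volume.restrict (Ioc a b) := by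
      rw [uIoc_of_le ht.1]
      exact Measure.restrict_mono (Ioc_subset_Ioc_right ht.2) le_rfl
    rw [← restrict_Ioo_eq_restrict_Ioc] at hsub
    refine intervalIntegral.tendsto_integral_filter_of_dominated_convergence (fun _ => (K : ℝ))
      (Eventually.of_forall fun n => (hF.meas _ (hadm _)).mono_measure hsub)
      (Eventually.of_forall fun n => Eventually.of_forall fun s _ => hK _ _)
      intervalIntegrable_const ?_
    rw [← ae_restrict_iff' measurableSet_uIoc]
    filter_upwards [ae_mono hsub hF.cont] with s hs
    exact hs _ _ (fun n => hadm _) ⟨⟨K, hw'L⟩, hw'a⟩ hlim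
  have hδ : Tendsto (fun n : ℕ => (K : ℝ) * (1 / ((φ n : ℝ) + 1))) atTop (𝓝 0) := by
    simpa using (tendsto_one_div_add_atTop_nhds_zero_nat.comp hφ.tendsto_atTop).const_mul (K : ℝ)
  have hdiff : Tendsto (fun n => w (φ n) t - (w₀ + ∫ s in a..t, F s (w (φ n)))) atTop (𝓝 0) := by
    refine squeeze_zero_norm (fun n => ?_) hδ
    have hp : (0 : ℝ) < 1 / ((φ n : ℝ) + 1) := Nat.one_div_pos_of_nat
    have hm : max a (t - 1 / ((φ n : ℝ) + 1)) ∈ Icc a b :=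
      ⟨le_max_left _ _, max_le hab (by linarith [ht.2])⟩
    rw [hw _ t ht, add_sub_add_left_eq_sub, intervalIntegral.integral_interval_sub_left
      (intervalIntegrable_of_bound (hF.meas _ (hadm _)) (fun s => hK s _) ha hm)
      (intervalIntegrable_of_bound (hF.meas _ (hadm _)) (fun s => hK s _) ha ht)]
    refine (intervalIntegral.norm_integral_le_of_norm_le_const fun s _ => hK s _).trans ?_
    gcongr
    rw [abs_le]
    constructor
    · linarith [le_max_right a (t - 1 / ((φ n : ℝ) + 1))]
    · have : max a (t - 1 / ((φ n : ℝ) + 1)) ≤ t := max_le ht.1 (by linarith)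
      linarith
  have := (hlim.tendsto_at ht).sub (hint.const_add w₀)
  exact sub_eq_zero.1 (tendsto_nhds_unique this hdiff)

end Peano

/-- The constant of the discretised Grönwall inequality. -/
def growthConst (C ℓ : ℝ) : ℝ := 2 ^ ⌈2 * C * ℓ⌉₊

lemma one_le_growthConst (C ℓ : ℝ) : 1 ≤ growthConst C ℓ := one_le_pow₀ one_le_two

lemma le_growthConst_mul {m : ℝ → ℝ} {a b C : ℝ} (hC : 0 ≤ C) (hm : ∀ t ∈ Icc a b, 0 ≤ m t)
    (h : ∀ s t, a ≤ s → s ≤ t → t ≤ b → m t ≤ m s + C * (t - s) * m t) :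
    ∀ t ∈ Icc a b, m t ≤ growthConst C (b - a) * m a := by
  have key : ∀ n : ℕ, ∀ t ∈ Icc a b, 2 * C * (t - a) ≤ n → m t ≤ 2 ^ n * m a := by
    intro n
    induction n with
    | zero =>
      intro t ht hn
      have h0 := mul_nonneg hC (sub_nonneg.2 ht.1)
      have h1 : C * (t - a) = 0 := by push_cast at hn; linarith
      simpa [h1] using h a t le_rfl ht.1 ht.2
    | succ n ih =>
      intro t ht hn
      push_cast at hn
      rcases hC.eq_or_lt with rfl | hC
      · have h1 := ih t ht (by simp)
        have h2 := hm a ⟨le_rfl, ht.1.trans ht.2⟩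
        refine h1.trans (mul_le_mul_of_nonneg_right ?_ h2)
        exact pow_le_pow_right₀ one_le_two n.le_succ
      set s := max a (t - 1 / (2 * C)) with hs
      have hsa : a ≤ s := le_max_left _ _
      have hst : s ≤ t := max_le ht.1 (by linarith [show 0 < 1 / (2 * C) by positivity])
      have h1 : C * (t - s) ≤ 1 / 2 := by
        have : t - s ≤ 1 / (2 * C) := by linarith [le_max_right a (t - 1 / (2 * C))]
        calc C * (t - s) ≤ C * (1 / (2 * C)) := by gcongr
          _ = 1 / 2 := by field_simp
      have h2 : m s ≤ 2 ^ n * m a := by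
        refine ih s ⟨hsa, hst.trans ht.2⟩ ?_
        rcases max_cases a (t - 1 / (2 * C)) with ⟨h3, -⟩ | ⟨h3, -⟩
        · rw [hs, h3]; simp
        · rw [hs, h3]
          have : 2 * C * (t - 1 / (2 * C) - a) = 2 * C * (t - a) - 1 := by
            field_simp
            ring
          linarith
      have h3 := h s t hsa hst ht.2
      have h4 : C * (t - s) * m t ≤ 1 / 2 * m t := by
        have := hm t ht
        gcongr
      rw [pow_succ]
      linarith
  intro t ht
  refine key _ t ht (le_trans ?_ (Nat.le_ceil _))
  have := ht.2
  gcongr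

lemma one_add_norm_le_growthConst {V : Type*} [NormedAddCommGroup V] {f : ℝ → V} {a b C : ℝ}
    (hC : 0 ≤ C) (hf : ContinuousOn f (Icc a b))
    (h : ∀ s t, a ≤ s → s ≤ t → t ≤ b → ∀ B, (∀ r ∈ Icc a t, ‖f r‖ ≤ B) →
      ‖f t - f s‖ ≤ C * (t - s) * (1 + B)) :
    ∀ t ∈ Icc a b, 1 + ‖f t‖ ≤ growthConst C (b - a) * (1 + ‖f a‖) := by
  have hbdd : ∀ t ≤ b, BddAbove ((fun r => ‖f r‖) '' Icc a t) := fun t ht =>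
    (isCompact_Icc.bddAbove_image hf.norm).mono (image_mono (Icc_subset_Icc_right ht))
  have hle : ∀ t ≤ b, ∀ r ∈ Icc a t, ‖f r‖ ≤ sSup ((fun r => ‖f r‖) '' Icc a t) :=
    fun t ht r hr => le_csSup (hbdd t ht) (mem_image_of_mem _ hr)
  have key := le_growthConst_mul (m := fun t => 1 + sSup ((fun r => ‖f r‖) '' Icc a t))
    (a := a) (b := b) hC
    (fun t ht => by
      have := (norm_nonneg _).trans (hle t ht.2 t ⟨ht.1, le_rfl⟩)
      positivity) ?_
  · intro t ht
    have h1 := key t ht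
    have h2 := hle t ht.2 t ⟨ht.1, le_rfl⟩
    simp only [Icc_self, image_singleton, csSup_singleton] at h1
    linarith
  · intro s t has hst htb
    set B := sSup ((fun r => ‖f r‖) '' Icc a t) with hB
    have hB0 : 0 ≤ B := (norm_nonneg _).trans (hle t htb t ⟨has.trans hst, le_rfl⟩)
    suffices B ≤ sSup ((fun r => ‖f r‖) '' Icc a s) + C * (t - s) * (1 + B) by linarith
    refine csSup_le ((nonempty_Icc.2 (has.trans hst)).image _) ?_
    rintro _ ⟨r, hr, rfl⟩
    have h0 : 0 ≤ C * (t - s) * (1 + B) := by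
      have := sub_nonneg.2 hst
      positivity
    rcases le_total r s with hrs | hsr
    · linarith [hle s (hst.trans htb) r ⟨hr.1, hrs⟩]
    · have h1 := h s r has hsr (hr.2.trans htb) B fun q hq => hle t htb q ⟨hq.1, hq.2.trans hr.2⟩
      have h2 : C * (r - s) * (1 + B) ≤ C * (t - s) * (1 + B) := by
        have := hr.2
        gcongr
      have h3 := hle s (hst.trans htb) s ⟨has, le_rfl⟩
      have h4 := norm_sub_norm_le (f r) (f s)
      dsimp only
      linarith

section Growth

variable {V : Type*} [NormedAddCommGroup V] [NormedSpace ℝ V]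

/-- Radial truncation at radius `K`. -/
def radialClip (K : ℝ) (v : V) : V := (K / max K ‖v‖) • v

lemma continuous_radialClip {K : ℝ} (hK : 0 < K) : Continuous (radialClip K : V → V) := by
  unfold radialClip
  refine Continuous.smul (continuous_const.div (by fun_prop) fun v => ?_) continuous_id
  exact (lt_max_of_lt_left hK).ne'

lemma norm_radialClip {K : ℝ} (hK : 0 < K) (v : V) :
    ‖radialClip K v‖ = K / max K ‖v‖ * ‖v‖ := by
  rw [radialClip, norm_smul, Real.norm_of_nonneg]
  exact div_nonneg hK.le (hK.le.trans (le_max_left _ _))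

lemma norm_radialClip_le {K : ℝ} (hK : 0 < K) (v : V) : ‖radialClip K v‖ ≤ K := by
  have h : 0 < max K ‖v‖ := lt_max_of_lt_left hK
  rw [norm_radialClip hK, div_mul_eq_mul_div, div_le_iff₀ h]
  gcongr
  exact le_max_right _ _

lemma norm_radialClip_le_norm {K : ℝ} (hK : 0 < K) (v : V) : ‖radialClip K v‖ ≤ ‖v‖ := by
  have h : 0 < max K ‖v‖ := lt_max_of_lt_left hK
  rw [norm_radialClip hK]
  exact mul_le_of_le_one_left (norm_nonneg _) ((div_le_one h).2 (le_max_left _ _))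

lemma radialClip_of_le {K : ℝ} (hK : 0 < K) {v : V} (hv : ‖v‖ ≤ K) : radialClip K v = v := by
  rw [radialClip, max_eq_left hv, div_self hK.ne', one_smul]

/-- Existence for causal Carathéodory equations of linear growth. -/
theorem exists_solution [FiniteDimensional ℝ V] {a b : ℝ} (hab : a ≤ b) {w₀ : V}
    {F : ℝ → (ℝ → V) → V} (hF : IsCaratheodory a b w₀ F) {C : ℝ} (hC : 0 ≤ C)
    (hgrow : ∀ᵐ t ∂(volume.restrict (Ioo a b)), ∀ w, Admissible a w₀ w → ∀ B,
      (∀ s ∈ Icc a t, ‖w s‖ ≤ B) → ‖F t w‖ ≤ C * (1 + B)) :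
    ∃ w, Admissible a w₀ w ∧ IntegrableOn (fun t => F t w) (Icc a b) ∧
      ∀ t ∈ Icc a b, w t = w₀ + ∫ s in a..t, F s w := by
  set R : ℝ := growthConst C (b - a) * (1 + ‖w₀‖) with hR
  have hR1 : 1 ≤ R := one_le_mul_of_one_le_of_one_le (one_le_growthConst _ _)
    (by linarith [norm_nonneg w₀])
  set K : NNReal := ⟨C * R + 1, by positivity⟩ with hKdef
  have hKval : (K : ℝ) = C * R + 1 := rfl
  have hK : (0 : ℝ) < K := by rw [hKval]; positivity
  have hG : IsCaratheodory a b w₀ fun t w => radialClip (K : ℝ) (F t w) :=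
    { meas := fun w hw => (continuous_radialClip hK).comp_aestronglyMeasurable (hF.meas w hw)
      causal := fun w w' hw hw' c hc h => by
        filter_upwards [hF.causal w w' hw hw' c hc h] with t ht
        rw [ht]
      cont := by
        filter_upwards [hF.cont] with t ht w w' hw hw' h
        exact ((continuous_radialClip hK).tendsto _).comp (ht w w' hw hw' h) }
  have hbd : ∀ t w, ‖radialClip (K : ℝ) (F t w)‖ ≤ K := fun t w => norm_radialClip_le hK _
  obtain ⟨w, hwL, hw⟩ := exists_solution_of_bounded hab hG hbd
  have ha : a ∈ Icc a b := left_mem_Icc.2 hab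
  have hwa : w a = w₀ := by simpa using hw a ha
  have hadm : Admissible a w₀ w := ⟨⟨K, hwL⟩, hwa⟩
  have hii : ∀ p ∈ Icc a b, ∀ q ∈ Icc a b,
      IntervalIntegrable (fun t => radialClip (K : ℝ) (F t w)) volume p q := fun p hp q hq =>
    intervalIntegrable_of_bound (hG.meas w hadm) (fun t => hbd t w) hp hq
  have hbound : ∀ t ∈ Icc a b, 1 + ‖w t‖ ≤ R := by
    have := one_add_norm_le_growthConst (f := w) (a := a) (b := b) hC hwL.continuous.continuousOn ?_
    · rwa [hwa] at this
    intro s t has hst htb B hB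
    have hs : s ∈ Icc a b := ⟨has, hst.trans htb⟩
    have ht : t ∈ Icc a b := ⟨has.trans hst, htb⟩
    rw [hw t ht, hw s hs, add_sub_add_left_eq_sub,
      intervalIntegral.integral_interval_sub_left (hii a ha t ht) (hii a ha s hs)]
    have := intervalIntegral.norm_integral_le_of_norm_le_const_ae (a := s) (b := t)
      (C := C * (1 + B)) (f := fun t => radialClip (K : ℝ) (F t w)) ?_
    · rw [abs_of_nonneg (sub_nonneg.2 hst)] at this
      linarith
    rw [← ae_restrict_iff' measurableSet_uIoc, uIoc_of_le hst, ← restrict_Ioo_eq_restrict_Ioc]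
    filter_upwards [ae_restrict_mem measurableSet_Ioo,
      ae_restrict_of_ae_restrict_of_subset (Ioo_subset_Ioo has htb) hgrow] with r hr hg
    exact (norm_radialClip_le_norm hK _).trans
      (hg w hadm B fun q hq => hB q ⟨hq.1, hq.2.trans hr.2.le⟩)
  have hclip : ∀ᵐ t ∂(volume.restrict (Ioo a b)), radialClip (K : ℝ) (F t w) = F t w := by
    filter_upwards [ae_restrict_mem measurableSet_Ioo, hgrow] with t ht hg
    refine radialClip_of_le hK ?_
    have := hg w hadm (R - 1) fun s hs => by linarith [hbound s ⟨hs.1, hs.2.trans ht.2.le⟩]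
    rw [hKval]
    linarith
  refine ⟨w, hadm, ?_, fun t ht => ?_⟩
  · rw [integrableOn_Icc_iff_integrableOn_Ioo]
    exact (Integrable.of_bound (hG.meas w hadm) K
      (Eventually.of_forall fun t => hbd t w)).congr hclip
  · rw [hw t ht]
    congr 1
    rw [intervalIntegral.integral_of_le ht.1, intervalIntegral.integral_of_le ht.1,
      integral_Ioc_eq_integral_Ioo, integral_Ioc_eq_integral_Ioo]
    exact integral_congr_ae
      (ae_restrict_of_ae_restrict_of_subset (Ioo_subset_Ioo_right ht.2) hclip)

end Growth

/-! ### Càdlàg paths -/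

section Paths

variable {T : ℝ} {d : ℕ}

lemma bddAbove_norm_of_cadlag {x : Path d} (hx : x ∈ Cadlag T d) :
    BddAbove ((fun s => ‖x s‖) '' Icc 0 T) := by
  have key : ∀ l : E d, ∀ F : Filter ℝ, Tendsto x F (𝓝 l) →
      ∃ s ∈ F, BddAbove ((fun s => ‖x s‖) '' s) := by
    intro l F h
    refine ⟨_, h.norm.eventually_lt_const (lt_add_one ‖l‖), ‖l‖ + 1, ?_⟩
    rintro _ ⟨s, hs, rfl⟩
    exact le_of_lt hs
  refine isCompact_Icc.induction_on (p := fun s => BddAbove ((fun s => ‖x s‖) '' s)) (by simp)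
    (fun s t hst ht => ht.mono (image_mono hst))
    (fun s t hs ht => by rw [image_union]; exact hs.union ht) fun t ht => ?_
  have hleft : ∃ s ∈ 𝓝[Icc 0 T ∩ Iio t] t, BddAbove ((fun s => ‖x s‖) '' s) := by
    rcases ht.1.eq_or_lt with rfl | h0
    · refine ⟨∅, ?_, by simp⟩
      have : Icc 0 T ∩ Iio 0 = (∅ : Set ℝ) := by
        ext s; simp only [mem_inter_iff, mem_Icc, mem_Iio, mem_empty_iff_false, iff_false]
        intro h; linarith [h.1.1, h.2]
      rw [this, nhdsWithin_empty]
      exact mem_bot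
    · obtain ⟨l, hl⟩ := hx.2 t ⟨h0, ht.2⟩
      exact key l _ (hl.mono_left (nhdsWithin_mono _ inter_subset_right))
  have hright : ∃ s ∈ 𝓝[Icc 0 T ∩ Ici t] t, BddAbove ((fun s => ‖x s‖) '' s) := by
    rcases ht.2.eq_or_lt with rfl | h0
    · refine ⟨{t}, ?_, by simp⟩
      refine mem_of_superset self_mem_nhdsWithin fun s hs => ?_
      exact le_antisymm hs.1.2 hs.2
    · exact key _ _ ((hx.1 t ⟨ht.1, h0⟩).mono_left (nhdsWithin_mono _ inter_subset_right))
  obtain ⟨s, hs, hsb⟩ := hleft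
  obtain ⟨s', hs', hsb'⟩ := hright
  refine ⟨s ∪ s', ?_, by rw [image_union]; exact hsb.union hsb'⟩
  have : Icc 0 T = (Icc 0 T ∩ Iio t) ∪ (Icc 0 T ∩ Ici t) := by
    rw [← inter_union_distrib_left, Iio_union_Ici, inter_univ]
  rw [this, nhdsWithin_union]
  exact ⟨mem_of_superset hs subset_union_left, mem_of_superset hs' subset_union_right⟩

lemma norm_le_runSup {x : Path d} (hx : x ∈ Cadlag T d) {s t : ℝ} (hs : s ∈ Icc 0 t)
    (ht : t ≤ T) : ‖x s‖ ≤ runSup d x t :=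
  le_csSup ((bddAbove_norm_of_cadlag hx).mono (image_mono (Icc_subset_Icc_right ht)))
    (mem_image_of_mem _ hs)

lemma runSup_nonneg (x : Path d) (t : ℝ) : 0 ≤ runSup d x t :=
  Real.sSup_nonneg (by rintro _ ⟨s, -, rfl⟩; exact norm_nonneg _)

lemma runSup_le {x : Path d} {t B : ℝ} (hB : 0 ≤ B) (h : ∀ s ∈ Icc 0 t, ‖x s‖ ≤ B) :
    runSup d x t ≤ B :=
  Real.sSup_le (by rintro _ ⟨s, hs, rfl⟩; exact h s hs) hB

lemma runSup_congr {x x' : Path d} {t : ℝ} (h : EqOn x x' (Icc 0 t)) :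
    runSup d x t = runSup d x' t := by
  unfold runSup
  congr 1
  exact image_congr fun s hs => by rw [h hs]

lemma supDist_le {x x' : Path d} {B : ℝ} (hB : 0 ≤ B) (h : ∀ s ∈ Icc 0 T, ‖x s - x' s‖ ≤ B) :
    supDist T d x x' ≤ B :=
  Real.sSup_le (by rintro _ ⟨s, hs, rfl⟩; exact h s hs) hB

lemma cadlag_of_continuousOn {x₀ x : Path d} {s₀ : ℝ} (hx₀ : x₀ ∈ Cadlag T d)
    (heq : EqOn x x₀ (Icc 0 s₀)) (hc : ContinuousOn x (Icc s₀ T)) :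
    x ∈ Cadlag T d := by
  refine ⟨fun t ht => ?_, fun t ht => ?_⟩
  · rcases lt_or_ge t s₀ with h | h
    · refine (hx₀.1 t ht).congr_of_eventuallyEq ?_ (heq ⟨ht.1, h.le⟩)
      filter_upwards [Ico_mem_nhdsGE h] with s hs
      exact heq ⟨ht.1.trans hs.1, hs.2.le⟩
    · exact (hc t ⟨h, ht.2.le⟩).mono_of_mem_nhdsWithin
        (mem_of_superset (Icc_mem_nhdsGE ht.2) (Icc_subset_Icc_left h))
  · rcases le_or_gt t s₀ with h | h
    · obtain ⟨l, hl⟩ := hx₀.2 t ht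
      refine ⟨l, hl.congr' ?_⟩
      filter_upwards [Ioo_mem_nhdsLT ht.1] with s hs
      exact (heq ⟨hs.1.le, hs.2.le.trans h⟩).symm
    · refine ⟨x t, ((hc t ⟨h.le, ht.2⟩).mono_of_mem_nhdsWithin ?_).tendsto⟩
      exact mem_of_superset (Ioo_mem_nhdsLT h) fun s hs => ⟨hs.1.le, hs.2.le.trans ht.2⟩

/-- The path following `x₀` up to time `s₀` and `ξ` afterwards. -/
def glue (s₀ : ℝ) (x₀ ξ : Path d) : Path d := fun t => if t ≤ s₀ then x₀ t else ξ t

lemma glue_of_le {s₀ t : ℝ} (x₀ ξ : Path d) (h : t ≤ s₀) : glue s₀ x₀ ξ t = x₀ t := if_pos h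

lemma glue_of_ge {s₀ t : ℝ} {x₀ ξ : Path d} (hξ : ξ s₀ = x₀ s₀) (h : s₀ ≤ t) :
    glue s₀ x₀ ξ t = ξ t := by
  rcases h.eq_or_lt with rfl | h
  · rw [glue_of_le _ _ le_rfl, hξ]
  · exact if_neg (not_le.2 h)

lemma glue_mem_cadlag {x₀ ξ : Path d} {s₀ : ℝ} (hx₀ : x₀ ∈ Cadlag T d)
    (hξ : ξ s₀ = x₀ s₀) (hc : ContinuousOn ξ (Icc s₀ T)) :
    glue s₀ x₀ ξ ∈ Cadlag T d :=
  cadlag_of_continuousOn hx₀ (fun _ ht => glue_of_le _ _ ht.2)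
    (hc.congr fun _ ht => glue_of_ge hξ ht.1)

lemma integral_deriv_of_lipschitz {ξ : Path d} {K : NNReal} (hξ : LipschitzWith K ξ) (a b : ℝ) :
    ∫ s in a..b, deriv ξ s = ξ b - ξ a := by
  have hdiff : ∀ᵐ s, DifferentiableAt ℝ ξ s := hξ.ae_differentiableAt_real
  have hint : IntervalIntegrable (deriv ξ) volume a b :=
    (intervalIntegrable_const (c := (K : ℝ))).mono_fun
      (stronglyMeasurable_deriv ξ).aestronglyMeasurable
      (Eventually.of_forall fun s => (norm_deriv_le_of_lipschitz hξ).trans (le_abs_self _))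
  refine ext_inner_left ℝ fun v => ?_
  have hv : LipschitzWith (‖innerSL ℝ v‖₊ * K) fun s => innerSL ℝ v (ξ s) :=
    (innerSL ℝ v).lipschitz.comp hξ
  have h1 := ((innerSL ℝ v).intervalIntegral_comp_comm hint).symm
  simp only [innerSL_apply_apply] at h1 hv
  rw [h1, inner_sub_right, ← hv.lipschitzOnWith.absolutelyContinuousOnInterval.integral_deriv_eq_sub]
  refine intervalIntegral.integral_congr_ae ?_
  filter_upwards [hdiff] with s hs _
  exact (((innerSL ℝ v).hasFDerivAt.comp_hasDerivAt s hs.hasDerivAt).deriv).symm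

lemma xDeriv_mono {x g : Path d} {L L' s₀ : ℝ} (h : L ≤ L') (hx : XDeriv T d L s₀ x g) :
    XDeriv T d L' s₀ x g := by
  refine ⟨hx.1, hx.2.1, hx.2.2.mono fun t ht => ht.trans ?_⟩
  have := runSup_nonneg x t
  gcongr

lemma xSet_mono {x₀ : Path d} {L L' s₀ : ℝ} (h : L ≤ L') :
    XSet T d L s₀ x₀ ⊆ XSet T d L' s₀ x₀ :=
  fun _ hx => ⟨hx.1, hx.2.1, hx.2.2.imp fun _ => xDeriv_mono h⟩

lemma glue_mem_xSet {x₀ ξ : Path d} {s₀ : ℝ} (hx₀ : x₀ ∈ Cadlag T d)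
    (hξ₀ : ξ s₀ = x₀ s₀) {K : NNReal} (hξ : LipschitzWith K ξ) :
    glue s₀ x₀ ξ ∈ XSet T d K s₀ x₀ := by
  refine ⟨glue_mem_cadlag hx₀ hξ₀ hξ.continuous.continuousOn, fun t ht => glue_of_le _ _ ht.2,
    deriv ξ, ?_, fun t ht => ?_, Eventually.of_forall fun t => ?_⟩
  · refine Integrable.of_bound (stronglyMeasurable_deriv ξ).aestronglyMeasurable (K : ℝ) ?_
    exact Eventually.of_forall fun s => norm_deriv_le_of_lipschitz hξ
  · rw [glue_of_ge hξ₀ ht.1, glue_of_le _ _ le_rfl, integral_deriv_of_lipschitz hξ, ← hξ₀]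
    abel
  · refine (norm_deriv_le_of_lipschitz hξ).trans ?_
    exact le_mul_of_one_le_right K.2 (by linarith [runSup_nonneg (glue s₀ x₀ ξ) t])

lemma xDeriv_continuousOn {x g : Path d} {L s₀ : ℝ} (h : XDeriv T d L s₀ x g) :
    ContinuousOn x (Icc s₀ T) := by
  refine ContinuousOn.congr ?_ h.2.1
  refine continuousOn_const.add ?_
  exact (intervalIntegral.continuousOn_primitive h.1).congr fun t ht =>
    intervalIntegral.integral_of_le ht.1

end Paths

/-! ### Consequences of the assumptions on the Hamiltonian -/

section Hamiltonian

variable {T : ℝ} {d : ℕ} {H : Ham d} {LH CH : ℝ} {M : ℝ → ℝ}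

lemma ae_restrict_Ioo_mono {p : ℝ → Prop} {a b a' b' : ℝ} (ha : a ≤ a') (hb : b' ≤ b)
    (h : ∀ᵐ t ∂(volume.restrict (Ioo a b)), p t) : ∀ᵐ t ∂(volume.restrict (Ioo a' b')), p t :=
  ae_restrict_of_ae_restrict_of_subset (Ioo_subset_Ioo ha hb) h

lemma ae_abs_ham_le (hH3 : HamLipZ T d H LH) (hH6 : HamBound T d H CH) :
    ∀ᵐ t ∂(volume.restrict (Ioo (0 : ℝ) T)), ∀ x ∈ Cadlag T d, ∀ (y : ℝ) (z : E d),
      |H t x y z| ≤ CH * (1 + runSup d x t + |y|) + LH * (1 + runSup d x t) * ‖z‖ := by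
  filter_upwards [hH3.2, hH6.2] with t h3 h6 x hx y z
  have h1 := h3 x hx y z 0
  have h2 := h6 x hx y
  rw [sub_zero] at h1
  have h4 := abs_sub_abs_le_abs_sub (H t x y z) (H t x y 0)
  linarith

lemma ae_tendsto_ham (hH1 : HamCont T d H) :
    ∀ᵐ t ∂(volume.restrict (Ioo (0 : ℝ) T)), ∀ (X : ℕ → Path d) (x : Path d) (Y : ℕ → ℝ) (y : ℝ)
      (z : E d), (∀ n, X n ∈ Cadlag T d) → x ∈ Cadlag T d →
      Tendsto (fun n => supDist T d x (X n)) atTop (𝓝 0) → Tendsto Y atTop (𝓝 y) →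
      Tendsto (fun n => H t (X n) (Y n) z) atTop (𝓝 (H t x y z)) := by
  filter_upwards [hH1] with t ht X x Y y z hX hx hXx hYy
  rw [Metric.tendsto_atTop']
  intro ε hε
  obtain ⟨δ, hδ, h⟩ := ht x hx y z ε hε
  have h1 := hXx.eventually_lt_const hδ
  have h2 := (tendsto_iff_dist_tendsto_zero.1 hYy).eventually_lt_const hδ
  obtain ⟨N, hN⟩ := eventually_atTop.1 (h1.and h2)
  refine ⟨N, fun n hn => ?_⟩
  obtain ⟨h3, h4⟩ := hN n hn.le
  rw [dist_comm, Real.dist_eq]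
  refine h _ (hX n) _ z h3 ?_ (by simpa using hδ)
  rwa [abs_sub_comm, ← Real.dist_eq]

lemma supDist_self (x : Path d) : supDist T d x x = 0 :=
  le_antisymm (supDist_le le_rfl fun s _ => by simp)
    (Real.sSup_nonneg (by rintro _ ⟨s, -, rfl⟩; exact norm_nonneg _))

lemma ae_continuous_ham (hH1 : HamCont T d H) :
    ∀ᵐ t ∂(volume.restrict (Ioo (0 : ℝ) T)), ∀ x ∈ Cadlag T d, ∀ z : E d,
      Continuous fun y => H t x y z := by
  filter_upwards [ae_tendsto_ham hH1] with t ht x hx z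
  refine continuous_iff_continuousAt.2 fun y => tendsto_nhds_iff_seq_tendsto.2 fun Y hY => ?_
  exact ht (fun _ => x) x Y y z (fun _ => hx) hx (by simp [supDist_self]) hY

lemma aestronglyMeasurable_ham (hH1 : HamCont T d H) (hH2 : HamMeas d H) {x : Path d}
    (hx : x ∈ Cadlag T d) (z : E d) {a b : ℝ} (ha : 0 ≤ a) (hb : b ≤ T) {y : ℝ → ℝ}
    (hy : AEMeasurable y (volume.restrict (Ioo a b))) :
    AEStronglyMeasurable (fun t => H t x (y t) z) (volume.restrict (Ioo a b)) := by
  suffices AEStronglyMeasurable (fun t => H t x (hy.mk y t) z) (volume.restrict (Ioo a b)) by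
    refine this.congr ?_
    filter_upwards [hy.ae_eq_mk] with t ht
    rw [ht]
  have hm := hy.measurable_mk
  set y' := hy.mk y
  refine aestronglyMeasurable_of_tendsto_ae atTop
    (f := fun (n : ℕ) t => H t x ((⌊((n : ℝ) + 1) * y' t⌋ : ℝ) / ((n : ℝ) + 1)) z)
    (fun n => ?_) ?_
  · have h1 : Measurable fun p : ℤ × ℝ => H p.2 x ((p.1 : ℝ) / ((n : ℝ) + 1)) z :=
      measurable_from_prod_countable_right fun k => hH2 x ((k : ℝ) / ((n : ℝ) + 1)) z
    have h2 : Measurable fun t => (⌊((n : ℝ) + 1) * y' t⌋, t) :=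
      ((hm.const_mul _).floor).prodMk measurable_id
    exact (h1.comp h2).aestronglyMeasurable
  · filter_upwards [ae_restrict_Ioo_mono ha hb (ae_continuous_ham hH1)] with t ht
    refine ((ht x hx z).tendsto (y' t)).comp ?_
    rw [tendsto_iff_dist_tendsto_zero]
    refine squeeze_zero (fun _ => dist_nonneg) (fun n => ?_) tendsto_one_div_add_atTop_nhds_zero_nat
    have hn : (0 : ℝ) < (n : ℝ) + 1 := by positivity
    rw [Real.dist_eq, abs_le]
    have h1 := Int.floor_le (((n : ℝ) + 1) * y' t)
    have h2 := Int.lt_floor_add_one (((n : ℝ) + 1) * y' t)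
    constructor
    · rw [neg_le_sub_iff_le_add, ← add_div, le_div_iff₀ hn]
      linarith
    · rw [tsub_le_iff_right]
      have : (⌊((n : ℝ) + 1) * y' t⌋ : ℝ) / ((n : ℝ) + 1) ≤ y' t := by
        rw [div_le_iff₀ hn]; linarith
      have : (0 : ℝ) < 1 / ((n : ℝ) + 1) := by positivity
      linarith

lemma ae_ham_causal (hH1 : HamCont T d H) (hH4 : HamLipX T d H M) {L : ℝ} (hL : 0 ≤ L) {t₀ : ℝ}
    (ht₀ : t₀ ∈ Ico 0 T) {x₀ : Path d} (hx₀ : x₀ ∈ Cadlag T d) {x x' : Path d}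
    (hx : x ∈ XSet T d L t₀ x₀) (hx' : x' ∈ XSet T d L t₀ x₀) {c : ℝ} (hc : c ≤ T)
    (heq : EqOn x x' (Icc 0 c)) (z : E d) :
    ∀ᵐ t ∂(volume.restrict (Ioo t₀ c)), ∀ y, H t x y z = H t x' y z := by
  have h1 : ∀ᵐ t ∂(volume.restrict (Ioo t₀ c)), ∀ q : ℚ, H t x q z = H t x' q z := by
    rw [ae_all_iff]
    intro q
    filter_upwards [ae_restrict_mem measurableSet_Ioo, ae_restrict_Ioo_mono le_rfl hc
      ((hH4 L hL).2 t₀ ht₀ x₀ hx₀ x hx x' hx' q z)] with t ht h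
    have h0 : sSup ((fun s => ‖x s - x' s‖) '' Icc 0 t) = 0 := by
      refine le_antisymm (Real.sSup_nonpos ?_) (Real.sSup_nonneg ?_) <;> rintro _ ⟨s, hs, rfl⟩
      · simp [heq ⟨hs.1, hs.2.trans ht.2.le⟩]
      · exact norm_nonneg _
    rw [h0, mul_zero] at h
    exact sub_eq_zero.1 (abs_nonpos_iff.1 h)
  filter_upwards [h1, ae_restrict_Ioo_mono ht₀.1 hc (ae_continuous_ham hH1)] with t ht hcont y
  exact congrFun (Rat.denseRange_cast.equalizer (hcont x hx.1 z) (hcont x' hx'.1 z)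
    (funext ht)) y

end Hamiltonian

/-- The standing assumptions on the Hamiltonian. -/
structure Standing (T : ℝ) (d : ℕ) (H : Ham d) (LH CH : ℝ) (M : ℝ → ℝ) : Prop where
  cont : HamCont T d H
  meas : HamMeas d H
  lipZ : HamLipZ T d H LH
  lipX : HamLipX T d H M
  mono : HamMono T d H
  bound : HamBound T d H CH

/-! ### Characteristics -/

section Characteristics

variable {T : ℝ} {d : ℕ} {H : Ham d} {LH CH : ℝ} {M : ℝ → ℝ}

/-- The velocity for which the characteristic equations for `z` and `z'` coincide. -/
def steer (H : Ham d) (z z' : E d) (t : ℝ) (x : Path d) (y : ℝ) : E d :=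
  ((H t x y z - H t x y z') / ‖z - z'‖ ^ 2) • (z - z')

lemma norm_steer_le {z z' : E d} {t : ℝ} {x : Path d} {y c : ℝ} (hc : 0 ≤ c)
    (h : |H t x y z - H t x y z'| ≤ c * ‖z - z'‖) : ‖steer H z z' t x y‖ ≤ c := by
  rcases eq_or_ne z z' with rfl | hz
  · simpa [steer] using hc
  have hp : 0 < ‖z - z'‖ := norm_pos_iff.2 (sub_ne_zero.2 hz)
  rw [steer, norm_smul, norm_div, norm_pow, norm_norm, Real.norm_eq_abs, div_mul_eq_mul_div,
    div_le_iff₀ (by positivity)]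
  nlinarith

lemma inner_steer (H : Ham d) (z z' : E d) (t : ℝ) (x : Path d) (y : ℝ) :
    ⟪steer H z z' t x y, z⟫_ℝ - H t x y z = ⟪steer H z z' t x y, z'⟫_ℝ - H t x y z' := by
  rcases eq_or_ne z z' with rfl | hz
  · rfl
  have hp : ‖z - z'‖ ^ 2 ≠ 0 := pow_ne_zero 2 (norm_ne_zero_iff.2 (sub_ne_zero.2 hz))
  have h : ⟪steer H z z' t x y, z - z'⟫_ℝ = H t x y z - H t x y z' := by
    rw [steer, real_inner_smul_left, real_inner_self_eq_norm_sq, div_mul_cancel₀ _ hp]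
  rw [inner_sub_right] at h
  linarith

/-- The right-hand side of the coupled equation solved by common characteristics for `z`
and `z'`. -/
def steerField (H : Ham d) (s₀ : ℝ) (x₀ : Path d) (z z' : E d) (t : ℝ) (w : ℝ → E d × ℝ) :
    E d × ℝ :=
  (steer H z z' t (glue s₀ x₀ fun s => (w s).1) (w t).2,
    ⟪steer H z z' t (glue s₀ x₀ fun s => (w s).1) (w t).2, z⟫_ℝ -
      H t (glue s₀ x₀ fun s => (w s).1) (w t).2 z)

lemma Admissible.glue_mem_xSet {s₀ : ℝ} {x₀ : Path d}
    (hx₀ : x₀ ∈ Cadlag T d) {y₀ : ℝ} {w : ℝ → E d × ℝ} (hw : Admissible s₀ (x₀ s₀, y₀) w) :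
    ∃ K : NNReal, glue s₀ x₀ (fun s => (w s).1) ∈ XSet T d K s₀ x₀ := by
  obtain ⟨⟨K, hK⟩, hw0⟩ := hw
  have : LipschitzWith (1 * K) fun s => (w s).1 := LipschitzWith.prod_fst.comp hK
  exact ⟨1 * K, PHJ.glue_mem_xSet hx₀ (by rw [hw0]) this⟩

lemma isCaratheodory_steerField (hS : Standing T d H LH CH M) {s₀ : ℝ} (hs₀ : s₀ ∈ Ico 0 T)
    {x₀ : Path d} (hx₀ : x₀ ∈ Cadlag T d) (y₀ : ℝ) (z z' : E d) :
    IsCaratheodory s₀ T (x₀ s₀, y₀) (steerField H s₀ x₀ z z') where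
  meas w hw := by
    obtain ⟨K, hK⟩ := hw.glue_mem_xSet hx₀
    have hy : AEMeasurable (fun t => (w t).2) (volume.restrict (Ioo s₀ T)) := by
      obtain ⟨⟨K', hK'⟩, -⟩ := hw
      exact (continuous_snd.comp hK'.continuous).aemeasurable
    have h1 := aestronglyMeasurable_ham hS.cont hS.meas hK.1 z hs₀.1 le_rfl hy
    have h2 := aestronglyMeasurable_ham hS.cont hS.meas hK.1 z' hs₀.1 le_rfl hy
    have h3 := ((h1.sub h2).aemeasurable.div_const (‖z - z'‖ ^ 2)).aestronglyMeasurable.smul_const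
      (z - z')
    exact h3.prodMk ((h3.inner aestronglyMeasurable_const).sub h1)
  causal w w' hw hw' c hc h := by
    obtain ⟨K, hK⟩ := hw.glue_mem_xSet hx₀
    obtain ⟨K', hK'⟩ := hw'.glue_mem_xSet hx₀
    have heq : EqOn (glue s₀ x₀ fun s => (w s).1) (glue s₀ x₀ fun s => (w' s).1) (Icc 0 c) := by
      intro s hs
      rcases le_or_gt s s₀ with h1 | h1
      · rw [glue_of_le _ _ h1, glue_of_le _ _ h1]
      · rw [glue_of_ge (by rw [hw.2]) h1.le, glue_of_ge (by rw [hw'.2]) h1.le, h ⟨h1.le, hs.2⟩]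
    have hm : 0 ≤ ((max K K' : NNReal) : ℝ) := NNReal.coe_nonneg _
    have key := fun z => ae_ham_causal hS.cont hS.lipX hm hs₀ hx₀
      (xSet_mono (NNReal.coe_le_coe.2 (le_max_left _ _)) hK)
      (xSet_mono (NNReal.coe_le_coe.2 (le_max_right _ _)) hK') hc.2 heq z
    filter_upwards [ae_restrict_mem measurableSet_Ioo, key z, key z'] with t ht hz hz'
    simp only [steerField, steer, hz, hz', h ⟨ht.1.le, ht.2.le⟩]
  cont := by
    filter_upwards [ae_restrict_mem measurableSet_Ioo,
      ae_restrict_Ioo_mono hs₀.1 le_rfl (ae_tendsto_ham hS.cont)] with t ht h w w' hw hw' hlim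
    have hX : ∀ n, glue s₀ x₀ (fun s => (w n s).1) ∈ Cadlag T d := fun n =>
      ((hw n).glue_mem_xSet hx₀).choose_spec.1
    have hX' := (hw'.glue_mem_xSet hx₀).choose_spec.1
    have hY : Tendsto (fun n => (w n t).2) atTop (𝓝 (w' t).2) :=
      (continuous_snd.tendsto _).comp (hlim.tendsto_at ⟨ht.1.le, ht.2.le⟩)
    have hD : Tendsto (fun n => supDist T d (glue s₀ x₀ fun s => (w' s).1)
        (glue s₀ x₀ fun s => (w n s).1)) atTop (𝓝 0) := by
      rw [Metric.tendsto_atTop]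
      intro ε hε
      obtain ⟨N, hN⟩ := eventually_atTop.1 (Metric.tendstoUniformlyOn_iff.1 hlim (ε / 2) (by linarith))
      refine ⟨N, fun n hn => ?_⟩
      have h1 : supDist T d (glue s₀ x₀ fun s => (w' s).1) (glue s₀ x₀ fun s => (w n s).1)
          ≤ ε / 2 := by
        refine supDist_le (by linarith) fun s hs => ?_
        rcases le_or_gt s s₀ with h1 | h1
        · rw [glue_of_le _ _ h1, glue_of_le _ _ h1, sub_self, norm_zero]; linarith
        · rw [glue_of_ge (by rw [hw'.2]) h1.le, glue_of_ge (by rw [(hw n).2]) h1.le,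
            ← dist_eq_norm]
          exact (le_max_left _ _).trans (hN n hn s ⟨h1.le, hs.2⟩).le
      have h0 : 0 ≤ supDist T d (glue s₀ x₀ fun s => (w' s).1) (glue s₀ x₀ fun s => (w n s).1) :=
        Real.sSup_nonneg (by rintro _ ⟨s, -, rfl⟩; exact norm_nonneg _)
      rw [Real.dist_0_eq_abs, abs_of_nonneg h0]
      linarith
    have h1 := h _ _ _ _ z hX hX' hD hY
    have h2 := h _ _ _ _ z' hX hX' hD hY
    have h3 := ((h1.sub h2).div_const (‖z - z'‖ ^ 2)).smul_const (z - z')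
    exact h3.prodMk_nhds ((h3.inner tendsto_const_nhds).sub h1)

lemma steerField_growth (hS : Standing T d H LH CH M) {s₀ : ℝ} (hs₀ : s₀ ∈ Ico 0 T)
    {x₀ : Path d} (hx₀ : x₀ ∈ Cadlag T d) (y₀ : ℝ) (z z' : E d) :
    ∀ᵐ t ∂(volume.restrict (Ioo s₀ T)), ∀ w, Admissible s₀ (x₀ s₀, y₀) w → ∀ B,
      (∀ s ∈ Icc s₀ t, ‖w s‖ ≤ B) →
      ‖steerField H s₀ x₀ z z' t w‖ ≤
        (LH + 2 * (LH * ‖z‖) + 2 * CH) * (1 + runSup d x₀ s₀) * (1 + B) := by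
  filter_upwards [ae_restrict_mem measurableSet_Ioo,
    ae_restrict_Ioo_mono hs₀.1 le_rfl (ae_abs_ham_le hS.lipZ hS.bound),
    ae_restrict_Ioo_mono hs₀.1 le_rfl hS.lipZ.2] with t ht hH hL w hw B hB
  have hX := (hw.glue_mem_xSet hx₀).choose_spec.1
  set x := glue s₀ x₀ fun s => (w s).1
  set R := runSup d x₀ s₀
  have hR : 0 ≤ R := runSup_nonneg _ _
  have hB0 : 0 ≤ B := (norm_nonneg _).trans (hB t ⟨ht.1.le, le_rfl⟩)
  have hy : |(w t).2| ≤ B := (le_max_right _ _).trans (hB t ⟨ht.1.le, le_rfl⟩)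
  have hsup : runSup d x t ≤ R + B := by
    refine runSup_le (by positivity) fun s hs => ?_
    rcases le_or_gt s s₀ with h1 | h1
    · rw [show x s = x₀ s from glue_of_le _ _ h1]
      linarith [norm_le_runSup hx₀ ⟨hs.1, h1⟩ hs₀.2.le]
    · rw [show x s = (w s).1 from glue_of_ge (by rw [hw.2]) h1.le]
      exact ((le_max_left _ _).trans (hB s ⟨h1.le, hs.2⟩)).trans (by linarith)
  have hLH := hS.lipZ.1
  have hCH := hS.bound.1
  have hsup0 := runSup_nonneg x t
  have hRB : 0 ≤ R * B := by positivity
  have e0 : 1 + runSup d x t ≤ (1 + R) * (1 + B) := by linarith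
  have e1 : 1 + runSup d x t + |(w t).2| ≤ 2 * ((1 + R) * (1 + B)) := by linarith
  have hg : ‖steer H z z' t x (w t).2‖ ≤ LH * ((1 + R) * (1 + B)) :=
    (norm_steer_le (by positivity) (hL x hX _ z z')).trans (by gcongr)
  have hH' : |H t x (w t).2 z| ≤ CH * (2 * ((1 + R) * (1 + B))) +
      LH * ((1 + R) * (1 + B)) * ‖z‖ :=
    (hH x hX _ z).trans (by gcongr)
  have hgz : |⟪steer H z z' t x (w t).2, z⟫_ℝ| ≤ LH * ((1 + R) * (1 + B)) * ‖z‖ :=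
    (abs_real_inner_le_norm _ _).trans (by gcongr)
  refine max_le (hg.trans ?_) ?_
  · have : 0 ≤ (2 * (LH * ‖z‖) + 2 * CH) * (1 + R) * (1 + B) := by positivity
    linarith
  · have : 0 ≤ LH * (1 + R) * (1 + B) := by positivity
    have h4 := abs_sub (⟪steer H z z' t x (w t).2, z⟫_ℝ) (H t x (w t).2 z)
    change |⟪steer H z z' t x (w t).2, z⟫_ℝ - H t x (w t).2 z| ≤ _
    linarith

theorem exists_common_characteristic (hS : Standing T d H LH CH M) {s₀ : ℝ}
    (hs₀ : s₀ ∈ Ico 0 T) {x₀ : Path d} (hx₀ : x₀ ∈ Cadlag T d) (y₀ : ℝ) (z z' : E d) :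
    ∃ p, p ∈ YSet T d H LH s₀ x₀ y₀ z ∧ p ∈ YSet T d H LH s₀ x₀ y₀ z' := by
  have hR := runSup_nonneg x₀ s₀
  have hLH := hS.lipZ.1
  have hCH := hS.bound.1
  obtain ⟨w, hw, hint, hsol⟩ := exists_solution hs₀.2.le
    (isCaratheodory_steerField hS hs₀ hx₀ y₀ z z') (by positivity)
    (steerField_growth hS hs₀ hx₀ y₀ z z')
  have hX := (hw.glue_mem_xSet hx₀).choose_spec.1
  set x := glue s₀ x₀ fun s => (w s).1 with hx
  have hxw : ∀ t, s₀ ≤ t → x t = (w t).1 := fun t ht => glue_of_ge (by rw [hw.2]) ht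
  have hcont : Continuous w := hw.1.choose_spec.continuous
  have hii : ∀ t ∈ Icc s₀ T,
      IntervalIntegrable (fun s => steerField H s₀ x₀ z z' s w) volume s₀ t := fun t ht =>
    (hint.mono_set (uIcc_subset_Icc ⟨le_rfl, hs₀.2.le⟩ ht)).intervalIntegrable
  have hfst : ∀ t ∈ Icc s₀ T, (w t).1 = x₀ s₀ + ∫ s in s₀..t, steer H z z' s x (w s).2 := by
    intro t ht
    have h1 := (ContinuousLinearMap.fst ℝ (E d) ℝ).intervalIntegral_comp_comm (hii t ht)
    rw [hsol t ht, Prod.fst_add]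
    exact congrArg _ h1.symm
  have hsnd : ∀ t ∈ Icc s₀ T, (w t).2 = y₀ + ∫ s in s₀..t,
      (⟪steer H z z' s x (w s).2, z⟫_ℝ - H s x (w s).2 z) := by
    intro t ht
    have h1 := (ContinuousLinearMap.snd ℝ (E d) ℝ).intervalIntegral_comp_comm (hii t ht)
    rw [hsol t ht, Prod.snd_add]
    exact congrArg _ h1.symm
  have hder : XDeriv T d LH s₀ x fun s => steer H z z' s x (w s).2 := by
    refine ⟨hint.fst, fun t ht => ?_, ?_⟩
    · rw [hxw t ht.1, hxw s₀ le_rfl, hw.2, hfst t ht]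
    · filter_upwards [ae_restrict_Ioo_mono hs₀.1 le_rfl hS.lipZ.2] with t ht
      have := runSup_nonneg x t
      exact norm_steer_le (by positivity) (ht x hX _ z z')
  have hpre : ∀ t ∈ Icc 0 s₀, x t = x₀ t := fun t ht => glue_of_le _ _ ht.2
  refine ⟨(x, fun t => (w t).2), ⟨hX, hpre, (continuous_snd.comp hcont).continuousOn,
    _, hder, hint.snd, hsnd⟩, ⟨hX, hpre, (continuous_snd.comp hcont).continuousOn, _, hder, ?_, ?_⟩⟩
  · simp only [← inner_steer H z z']
    exact hint.snd
  · simp only [← inner_steer H z z']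
    exact hsnd

end Characteristics

section Comparison

variable {T : ℝ} {d : ℕ} {H : Ham d} {LH CH : ℝ} {M : ℝ → ℝ}

/-- Two primitives whose integrands agree wherever `w` exceeds `y` keep their initial order. -/
lemma le_of_primitive {a b : ℝ} {w y f g : ℝ → ℝ} (hw : ContinuousOn w (Icc a b))
    (hy : ContinuousOn y (Icc a b)) (hfi : IntegrableOn f (Icc a b))
    (hgi : IntegrableOn g (Icc a b)) (hf : ∀ t ∈ Icc a b, w t = w a + ∫ s in a..t, f s)
    (hg : ∀ t ∈ Icc a b, y t = y a + ∫ s in a..t, g s) (h₀ : w a ≤ y a)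
    (h : ∀ t ∈ Icc a b, y t < w t → f t = g t) : ∀ t ∈ Icc a b, w t ≤ y t := by
  intro t ht
  by_contra! hlt
  set S := {s ∈ Icc a t | w s ≤ y s} with hS
  have hsub : Icc a t ⊆ Icc a b := Icc_subset_Icc_right ht.2
  have hSc : IsCompact S := by
    refine isCompact_Icc.of_isClosed_subset ?_ (sep_subset _ _)
    exact isClosed_Icc.isClosed_le (hw.mono hsub) (hy.mono hsub)
  obtain ⟨τ, hτ, hmax⟩ := hSc.exists_isGreatest ⟨a, ⟨le_rfl, ht.1⟩, h₀⟩
  have hτb := hsub hτ.1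
  have key : ∀ f : ℝ → ℝ, IntegrableOn f (Icc a b) →
      (∫ s in a..t, f s) - ∫ s in a..τ, f s = ∫ s in τ..t, f s := fun f hf =>
    intervalIntegral.integral_interval_sub_left
      (hf.mono_set (uIcc_subset_Icc (left_mem_Icc.2 (ht.1.trans ht.2)) ht)).intervalIntegrable
      (hf.mono_set (uIcc_subset_Icc (left_mem_Icc.2 (ht.1.trans ht.2)) hτb)).intervalIntegrable
  have heq : ∫ s in τ..t, f s = ∫ s in τ..t, g s := by
    refine intervalIntegral.integral_congr_Ioo_of_le hτ.1.2 fun s hs => ?_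
    refine h s ⟨hτ.1.1.trans hs.1.le, hs.2.le.trans ht.2⟩ ?_
    by_contra! hle
    exact hs.1.not_ge (hmax ⟨⟨hτ.1.1.trans hs.1.le, hs.2.le⟩, hle⟩)
  have := hτ.2
  rw [hf t ht, hg t ht] at hlt
  rw [hf τ hτb, hg τ hτb] at this
  linarith [key f hfi, key g hgi]

theorem exists_lower_characteristic (hS : Standing T d H LH CH M) {L : ℝ} (hL : 0 ≤ L) {s₀ : ℝ}
    (hs₀ : s₀ ∈ Ico 0 T) {x₀ : Path d} {r c : ℝ} {z : E d} {p : Path d × (ℝ → ℝ)}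
    (hp : p ∈ YSet T d H L s₀ x₀ r z) (hc : c ≤ r) :
    ∃ q ∈ YSet T d H L s₀ x₀ c z, q.1 = p.1 ∧ ∀ t ∈ Icc s₀ T, q.2 t ≤ p.2 t := by
  obtain ⟨x, y⟩ := p
  obtain ⟨hx, hpre, hyc, g, hg, hint, hy⟩ := hp
  dsimp only at hx hpre hyc hg hint hy
  have hLH := hS.lipZ.1
  have hCH := hS.bound.1
  set R := runSup d x T
  have hR : 0 ≤ R := runSup_nonneg x T
  obtain ⟨P, hP⟩ := isCompact_Icc.exists_bound_of_continuousOn hyc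
  have hP0 : 0 ≤ P := (norm_nonneg _).trans (hP s₀ (left_mem_Icc.2 hs₀.2.le))
  set F : ℝ → (ℝ → ℝ) → ℝ := fun t w => ⟪g t, z⟫_ℝ - H t x (min (w t) (y t)) z
  have hgi : AEStronglyMeasurable g (volume.restrict (Ioo s₀ T)) :=
    (hg.1.mono_set Ioo_subset_Icc_self).aestronglyMeasurable
  have hym : AEMeasurable y (volume.restrict (Ioo s₀ T)) :=
    (hyc.mono Ioo_subset_Icc_self).aemeasurable measurableSet_Ioo
  have hF : IsCaratheodory s₀ T c F :=
    { meas := fun w hw => by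
        obtain ⟨⟨K, hK⟩, -⟩ := hw
        exact (hgi.inner aestronglyMeasurable_const).sub
          (aestronglyMeasurable_ham hS.cont hS.meas hx z hs₀.1 le_rfl
            (hK.continuous.aemeasurable.min hym))
      causal := fun w w' _ _ c _ h => by
        filter_upwards [ae_restrict_mem measurableSet_Ioo] with t ht
        simp only [F, h ⟨ht.1.le, ht.2.le⟩]
      cont := by
        filter_upwards [ae_restrict_mem measurableSet_Ioo,
          ae_restrict_Ioo_mono hs₀.1 le_rfl (ae_continuous_ham hS.cont)] with t ht h w w' _ _ hlim
        have h1 := (hlim.tendsto_at ⟨ht.1.le, ht.2.le⟩).min (tendsto_const_nhds (x := y t))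
        exact tendsto_const_nhds.sub (((h x hx z).tendsto _).comp h1) }
  have hgrow : ∀ᵐ t ∂(volume.restrict (Ioo s₀ T)), ∀ w, Admissible s₀ c w → ∀ B,
      (∀ s ∈ Icc s₀ t, ‖w s‖ ≤ B) →
      ‖F t w‖ ≤ (L * (1 + R) * ‖z‖ + CH * (1 + R + P) + LH * (1 + R) * ‖z‖) * (1 + B) := by
    filter_upwards [ae_restrict_mem measurableSet_Ioo, hg.2.2,
      ae_restrict_Ioo_mono hs₀.1 le_rfl (ae_abs_ham_le hS.lipZ hS.bound)] with t ht hgt hH w _ B hB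
    have hB' := hB t ⟨ht.1.le, le_rfl⟩
    have hB0 : 0 ≤ B := (norm_nonneg _).trans hB'
    have hRt : runSup d x t ≤ R := runSup_le hR fun s hs =>
      norm_le_runSup hx ⟨hs.1, hs.2.trans ht.2.le⟩ le_rfl
    have hmin : |min (w t) (y t)| ≤ B + P := by
      have h1 := abs_le.1 hB'
      have h2 := abs_le.1 (hP t ⟨ht.1.le, ht.2.le⟩)
      exact abs_le.2 ⟨le_min (by linarith) (by linarith), (min_le_left _ _).trans (by linarith)⟩
    have h1 : |⟪g t, z⟫_ℝ| ≤ L * (1 + R) * ‖z‖ :=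
      (abs_real_inner_le_norm _ _).trans (by gcongr; exact hgt.trans (by gcongr))
    have h2 : |H t x (min (w t) (y t)) z| ≤ CH * (1 + R + (B + P)) + LH * (1 + R) * ‖z‖ :=
      (hH x hx _ z).trans (by gcongr)
    have h3 := abs_sub (⟪g t, z⟫_ℝ) (H t x (min (w t) (y t)) z)
    have h4 : 0 ≤ L * (1 + R) * ‖z‖ * B := by positivity
    have h5 : 0 ≤ CH * (R + P) * B := by positivity
    have h6 : 0 ≤ LH * (1 + R) * ‖z‖ * B := by positivity
    rw [Real.norm_eq_abs]
    change |⟪g t, z⟫_ℝ - H t x (min (w t) (y t)) z| ≤ _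
    linarith
  obtain ⟨w, hw, hwi, hsol⟩ := exists_solution hs₀.2.le hF (by positivity) hgrow
  have hwc : ContinuousOn w (Icc s₀ T) := hw.1.choose_spec.continuous.continuousOn
  have hy0 : y s₀ = r := by simpa using hy s₀ (left_mem_Icc.2 hs₀.2.le)
  have hle : ∀ t ∈ Icc s₀ T, w t ≤ y t :=
    le_of_primitive hwc hyc hwi hint (by rwa [hw.2]) (by rwa [hy0]) (by rwa [hw.2, hy0])
      fun t _ hlt => by simp only [F, min_eq_right hlt.le]
  have hFw : EqOn (fun t => F t w) (fun t => ⟪g t, z⟫_ℝ - H t x (w t) z) (Icc s₀ T) :=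
    fun t ht => by simp only [F, min_eq_left (hle t ht)]
  refine ⟨(x, w), ⟨hx, hpre, hwc, g, hg, hwi.congr_fun hFw measurableSet_Icc, fun t ht => ?_⟩,
    rfl, hle⟩
  refine (hsol t ht).trans (congrArg (c + ·) ?_)
  refine intervalIntegral.integral_congr fun s hs => hFw ?_
  exact uIcc_subset_Icc (left_mem_Icc.2 hs₀.2.le) ht hs

end Comparison

section Concatenation

variable {T : ℝ} {d : ℕ} {H : Ham d} {LH CH : ℝ} {M : ℝ → ℝ}

/-- Primitives can be concatenated. -/
lemma concat_primitive {V : Type*} [NormedAddCommGroup V] [NormedSpace ℝ V] {a s b : ℝ}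
    (hs : s ∈ Icc a b) {v₀ : V} {v w f fp fq : ℝ → V}
    (hfp : IntegrableOn fp (Icc a b)) (hfq : IntegrableOn fq (Icc s b))
    (hv : ∀ t ∈ Icc a b, v t = v₀ + ∫ r in a..t, fp r)
    (hw : ∀ t ∈ Icc s b, w t = v s + ∫ r in s..t, fq r)
    (h₁ : ∀ᵐ t ∂(volume.restrict (Ioo a s)), f t = fp t)
    (h₂ : ∀ᵐ t ∂(volume.restrict (Ioo s b)), f t = fq t) :
    IntegrableOn f (Icc a b) ∧
      ∀ t ∈ Icc a b, (if t ≤ s then v t else w t) = v₀ + ∫ r in a..t, f r := by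
  have h₁' : ∀ᵐ t ∂(volume.restrict (Icc a s)), f t = fp t := by
    rwa [← restrict_Ioo_eq_restrict_Icc]
  have h₂' : ∀ᵐ t ∂(volume.restrict (Icc s b)), f t = fq t := by
    rwa [← restrict_Ioo_eq_restrict_Icc]
  have hf₁ : IntegrableOn f (Icc a s) :=
    (hfp.mono_set (Icc_subset_Icc_right hs.2)).congr (h₁'.mono fun _ h => h.symm)
  have hf₂ : IntegrableOn f (Icc s b) := hfq.congr (h₂'.mono fun _ h => h.symm)
  have hint₁ : ∀ t ∈ Icc a s, ∫ r in a..t, f r = ∫ r in a..t, fp r := fun t ht =>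
    intervalIntegral.integral_congr_ae_restrict <| ae_restrict_of_ae_restrict_of_subset
      (uIoc_subset_uIcc.trans (uIcc_subset_Icc (left_mem_Icc.2 hs.1) ht)) h₁'
  have hint₂ : ∀ t ∈ Icc s b, ∫ r in s..t, f r = ∫ r in s..t, fq r := fun t ht =>
    intervalIntegral.integral_congr_ae_restrict <| ae_restrict_of_ae_restrict_of_subset
      (uIoc_subset_uIcc.trans (uIcc_subset_Icc (left_mem_Icc.2 hs.2) ht)) h₂'
  refine ⟨?_, fun t ht => ?_⟩
  · rw [← Icc_union_Icc_eq_Icc hs.1 hs.2]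
    exact hf₁.union hf₂
  · split_ifs with h
    · rw [hv t ht, hint₁ t ⟨ht.1, h⟩]
    · have hst : t ∈ Icc s b := ⟨(not_le.1 h).le, ht.2⟩
      rw [hw t hst, hv s hs, ← hint₂ t hst, ← hint₁ s (right_mem_Icc.2 hs.1), add_assoc,
        intervalIntegral.integral_add_adjacent_intervals]
      · exact (hf₁.mono_set (uIcc_subset_Icc (left_mem_Icc.2 hs.1)
          (right_mem_Icc.2 hs.1))).intervalIntegrable
      · exact (hf₂.mono_set (uIcc_subset_Icc (left_mem_Icc.2 hs.2) hst)).intervalIntegrable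

lemma continuousOn_concat {V : Type*} [TopologicalSpace V] {a s b : ℝ} {v w : ℝ → V}
    (hs : s ∈ Icc a b) (hv : ContinuousOn v (Icc a b)) (hw : ContinuousOn w (Icc s b))
    (h : v s = w s) : ContinuousOn (fun t => if t ≤ s then v t else w t) (Icc a b) := by
  rw [← Icc_union_Icc_eq_Icc hs.1 hs.2]
  refine ContinuousOn.union_of_isClosed ?_ ?_ isClosed_Icc isClosed_Icc
  · exact (hv.mono (Icc_subset_Icc_right hs.2)).congr fun t ht => if_pos ht.2
  · refine hw.congr fun t ht => ?_
    rcases ht.1.eq_or_lt with rfl | hlt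
    · simp [h]
    · exact if_neg hlt.not_ge

theorem concat_mem_ySet (hS : Standing T d H LH CH M) {L : ℝ} (hL : 0 ≤ L) {t₀ s : ℝ}
    (ht₀ : t₀ ∈ Ico 0 T) (hs : s ∈ Icc t₀ T) {x₀ : Path d} (hx₀ : x₀ ∈ Cadlag T d) {y₀ : ℝ}
    {z : E d} {p q : Path d × (ℝ → ℝ)} (hp : p ∈ YSet T d H L t₀ x₀ y₀ z)
    (hq : q ∈ YSet T d H L s p.1 (p.2 s) z) :
    (q.1, fun t => if t ≤ s then p.2 t else q.2 t) ∈ YSet T d H L t₀ x₀ y₀ z := by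
  obtain ⟨x, y⟩ := p
  obtain ⟨x', y'⟩ := q
  obtain ⟨hx, hpre, hyc, g, hg, hint, hy⟩ := hp
  obtain ⟨hx', hpre', hyc', g', hg', hint', hy'⟩ := hq
  dsimp only at *
  set G : Path d := fun t => if t ≤ s then g t else g' t
  have hG₁ : ∀ᵐ t ∂(volume.restrict (Ioo t₀ s)), G t = g t := by
    filter_upwards [ae_restrict_mem measurableSet_Ioo] with t ht using if_pos ht.2.le
  have hG₂ : ∀ᵐ t ∂(volume.restrict (Ioo s T)), G t = g' t := by
    filter_upwards [ae_restrict_mem measurableSet_Ioo] with t ht using if_neg ht.1.not_ge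
  have hxs : x' s = x s := hpre' s ⟨ht₀.1.trans hs.1, le_rfl⟩
  have hx'₀ : x' t₀ = x t₀ := hpre' t₀ ⟨ht₀.1, hs.1⟩
  have hys : y s = y' s := by simpa using (hy' s (left_mem_Icc.2 hs.2)).symm
  have hx'G : XDeriv T d L t₀ x' G := by
    obtain ⟨h1, h2⟩ := concat_primitive hs hg.1 hg'.1 hg.2.1 (hxs ▸ hg'.2.1) hG₁ hG₂
    refine ⟨h1, fun t ht => ?_, ?_⟩
    · rw [hx'₀, ← h2 t ht]
      split_ifs with h
      · exact hpre' t ⟨ht₀.1.trans ht.1, h⟩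
      · rfl
    · have key : ∀ᵐ t ∂(volume.restrict (Icc t₀ s ∪ Icc s T)), ‖G t‖ ≤ L * (1 + runSup d x' t) := by
        rw [ae_restrict_union_iff, ← restrict_Ioo_eq_restrict_Icc, ← restrict_Ioo_eq_restrict_Icc]
        constructor
        · filter_upwards [ae_restrict_mem measurableSet_Ioo, hG₁,
            ae_restrict_Ioo_mono le_rfl hs.2 hg.2.2] with t ht h1 h2
          rwa [h1, runSup_congr fun r hr => hpre' r ⟨hr.1, hr.2.trans ht.2.le⟩]
        · filter_upwards [hG₂, hg'.2.2] with t h1 h2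
          rwa [h1]
      rw [Icc_union_Icc_eq_Icc hs.1 hs.2] at key
      exact ae_restrict_of_ae_restrict_of_subset Ioo_subset_Icc_self key
  have hpre'' : ∀ t ∈ Icc 0 t₀, x' t = x₀ t := fun t ht =>
    (hpre' t ⟨ht.1, ht.2.trans hs.1⟩).trans (hpre t ht)
  have hcausal := ae_ham_causal hS.cont hS.lipX hL ht₀ hx₀ ⟨hx', hpre'', G, hx'G⟩
    ⟨hx, hpre, g, hg⟩ hs.2 hpre' z
  refine ⟨hx', hpre'', continuousOn_concat hs hyc hyc' hys, G, hx'G,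
    concat_primitive hs hint hint' hy hy' ?_ ?_⟩
  · filter_upwards [ae_restrict_mem measurableSet_Ioo, hG₁, hcausal] with t ht h1 h2
    rw [h1, h2, if_pos ht.2.le]
  · filter_upwards [ae_restrict_mem measurableSet_Ioo, hG₂] with t ht h1
    rw [h1, if_neg ht.1.not_ge]

end Concatenation

section Bounds

variable {T : ℝ} {d : ℕ} {H : Ham d} {LH CH : ℝ} {M : ℝ → ℝ}

lemma growthConst_mono {C ℓ ℓ' : ℝ} (hC : 0 ≤ C) (h : ℓ ≤ ℓ') :
    growthConst C ℓ ≤ growthConst C ℓ' :=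
  pow_le_pow_right₀ one_le_two (Nat.ceil_mono (by gcongr))

lemma norm_sub_le_of_primitive {V : Type*} [NormedAddCommGroup V] [NormedSpace ℝ V] {a b : ℝ}
    {v₀ : V} {v f : ℝ → V} (hf : IntegrableOn f (Icc a b))
    (hv : ∀ t ∈ Icc a b, v t = v₀ + ∫ r in a..t, f r) {s t K : ℝ} (has : a ≤ s) (hst : s ≤ t)
    (htb : t ≤ b) (h : ∀ᵐ r ∂(volume.restrict (Ioo s t)), ‖f r‖ ≤ K) :
    ‖v t - v s‖ ≤ K * (t - s) := by
  have hii : ∀ r ∈ Icc a b, IntervalIntegrable f volume a r := fun r hr =>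
    (hf.mono_set (uIcc_subset_Icc (left_mem_Icc.2 (hr.1.trans hr.2)) hr)).intervalIntegrable
  have hs : s ∈ Icc a b := ⟨has, hst.trans htb⟩
  have ht : t ∈ Icc a b := ⟨has.trans hst, htb⟩
  rw [hv t ht, hv s hs, add_sub_add_left_eq_sub,
    intervalIntegral.integral_interval_sub_left (hii t ht) (hii s hs)]
  refine (intervalIntegral.norm_integral_le_of_norm_le_const_ae (C := K) ?_).trans_eq
    (by rw [abs_of_nonneg (sub_nonneg.2 hst)])
  rw [uIoc_of_le hst]
  rw [restrict_Ioo_eq_restrict_Ioc] at h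
  exact (ae_restrict_iff' measurableSet_Ioc).1 h

/-- Paths in `X^L(t₀, x₀)` are uniformly bounded and uniformly Lipschitz on `[t₀, T]`. -/
lemma exists_lipschitz_bound {L : ℝ} (hL : 0 ≤ L) {t₀ : ℝ} (ht₀ : t₀ ∈ Ico 0 T) {x₀ : Path d}
    (hx₀ : x₀ ∈ Cadlag T d) :
    ∃ (R : ℝ) (K : NNReal), 0 ≤ R ∧ ∀ x ∈ XSet T d L t₀ x₀,
      (∀ t ∈ Icc 0 T, ‖x t‖ ≤ R) ∧ LipschitzOnWith K x (Icc t₀ T) := by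
  set R₀ := runSup d x₀ t₀
  have hR₀ : 0 ≤ R₀ := runSup_nonneg _ _
  set B₀ := growthConst (L * (1 + R₀)) (T - t₀) * (1 + R₀)
  have hB₀ : 0 ≤ B₀ := mul_nonneg (zero_le_one.trans (one_le_growthConst _ _)) (by positivity)
  refine ⟨R₀ + B₀, ⟨L * (1 + R₀) * (1 + B₀), by positivity⟩, by positivity, ?_⟩
  rintro x ⟨hx, hpre, g, hg⟩
  have hle₀ : ∀ r ∈ Icc 0 t₀, ‖x r‖ ≤ R₀ := fun r hr => by
    rw [hpre r hr]
    exact norm_le_runSup hx₀ hr ht₀.2.le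
  have hlip : ∀ s t, t₀ ≤ s → s ≤ t → t ≤ T → ∀ B, (∀ r ∈ Icc t₀ t, ‖x r‖ ≤ B) →
      ‖x t - x s‖ ≤ L * (1 + R₀) * (t - s) * (1 + B) := by
    intro s t hs hst ht B hB
    have hB0 : 0 ≤ B := (norm_nonneg _).trans (hB t ⟨hs.trans hst, le_rfl⟩)
    refine (norm_sub_le_of_primitive (K := L * ((1 + R₀) * (1 + B))) hg.1 hg.2.1 hs hst ht
      ?_).trans_eq (by ring)
    filter_upwards [ae_restrict_mem measurableSet_Ioo, ae_restrict_Ioo_mono hs ht hg.2.2] with r hr h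
    refine h.trans ?_
    have h1 : runSup d x r ≤ R₀ + B := by
      refine runSup_le (by positivity) fun q hq => ?_
      rcases le_total q t₀ with h2 | h2
      · linarith [hle₀ q ⟨hq.1, h2⟩]
      · linarith [hB q ⟨h2, hq.2.trans hr.2.le⟩]
    have h2 : 0 ≤ R₀ * B := by positivity
    have h3 : 1 + runSup d x r ≤ (1 + R₀) * (1 + B) := by linarith
    gcongr
  have hbd : ∀ t ∈ Icc t₀ T, ‖x t‖ ≤ B₀ := by
    intro t ht
    have h1 := one_add_norm_le_growthConst (by positivity) (xDeriv_continuousOn hg) hlip t ht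
    have h2 : growthConst (L * (1 + R₀)) (T - t₀) * (1 + ‖x t₀‖) ≤ B₀ := by
      have := hle₀ t₀ ⟨ht₀.1, le_rfl⟩
      have := zero_le_one.trans (one_le_growthConst (L * (1 + R₀)) (T - t₀))
      exact mul_le_mul_of_nonneg_left (by linarith) this
    linarith
  have hdist : ∀ s ∈ Icc t₀ T, ∀ t ∈ Icc t₀ T, s ≤ t →
      dist (x s) (x t) ≤ L * (1 + R₀) * (1 + B₀) * dist s t := fun s hs t ht hst => by
    rw [dist_comm, dist_comm s, dist_eq_norm, Real.dist_eq, abs_of_nonneg (sub_nonneg.2 hst)]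
    exact (hlip s t hs.1 hst ht.2 B₀ fun r hr => hbd r ⟨hr.1, hr.2.trans ht.2⟩).trans_eq (by ring)
  refine ⟨fun t ht => ?_, LipschitzOnWith.of_dist_le_mul fun s hs t ht => ?_⟩
  · rcases le_total t t₀ with h | h
    · linarith [hle₀ t ⟨ht.1, h⟩]
    · linarith [hbd t ⟨h, ht.2⟩]
  · rcases le_total s t with h | h
    · exact hdist s hs t ht h
    · rw [dist_comm, dist_comm s]
      exact hdist t ht s hs h

/-- A continuous terminal condition is bounded on `X^L(t₀, x₀)`. -/
lemma exists_bound_termCond {h : Path d → ℝ} (hh : TermCont T d h) {L : ℝ} (hL : 0 ≤ L) {t₀ : ℝ}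
    (ht₀ : t₀ ∈ Ico 0 T) {x₀ : Path d} (hx₀ : x₀ ∈ Cadlag T d) :
    ∃ B, ∀ x ∈ XSet T d L t₀ x₀, |h x| ≤ B := by
  by_contra! hcon
  obtain ⟨R, K, -, hRK⟩ := exists_lipschitz_bound hL ht₀ hx₀
  choose x hx hxn using fun n : ℕ => hcon n
  obtain ⟨φ, hφ, ξ, hξ, hlim⟩ := exists_subseq_tendstoUniformlyOn ht₀.2.le x
    (fun n => (hRK _ (hx n)).2) (fun n => (hRK _ (hx n)).1 t₀ ⟨ht₀.1, ht₀.2.le⟩)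
  have hxt : ∀ n, x n t₀ = x₀ t₀ := fun n => (hx n).2.1 t₀ ⟨ht₀.1, le_rfl⟩
  have hξ₀ : ξ t₀ = x₀ t₀ :=
    tendsto_nhds_unique (hlim.tendsto_at (left_mem_Icc.2 ht₀.2.le))
      (by simp only [hxt]; exact tendsto_const_nhds)
  have hX := glue_mem_cadlag hx₀ hξ₀ (hξ.continuous.continuousOn (s := Icc t₀ T))
  set X := glue t₀ x₀ ξ
  obtain ⟨δ, hδ, hXδ⟩ := hh X hX 1 one_pos
  obtain ⟨N, hN⟩ := eventually_atTop.1 (Metric.tendstoUniformlyOn_iff.1 hlim (δ / 2) (by positivity))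
  obtain ⟨m, hm⟩ := exists_nat_gt (|h X| + 1)
  set n := max N m
  have hdist : supDist T d X (x (φ n)) < δ := by
    refine (supDist_le (B := δ / 2) (by positivity) fun s hs => ?_).trans_lt (by linarith)
    rcases le_total s t₀ with h1 | h1
    · rw [show X s = x₀ s from glue_of_le _ _ h1, (hx _).2.1 s ⟨hs.1, h1⟩, sub_self, norm_zero]
      positivity
    · rw [show X s = ξ s from glue_of_ge hξ₀ h1, ← dist_eq_norm]
      exact (hN n (le_max_left _ _) s ⟨h1, hs.2⟩).le
  have h1 := hXδ _ (hx _).1 hdist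
  have h2 := hxn (φ n)
  have h3 : (m : ℝ) ≤ φ n := Nat.cast_le.2 ((le_max_right _ _).trans (hφ.id_le n))
  have h4 := abs_sub_abs_le_abs_sub (h (x (φ n))) (h X)
  linarith

/-- A characteristic that starts at a large value stays large, uniformly. -/
lemma exists_large (hS : Standing T d H LH CH M) {L : ℝ} (hL : 0 ≤ L) {t₀ : ℝ}
    (ht₀ : t₀ ∈ Ico 0 T) {x₀ : Path d} (hx₀ : x₀ ∈ Cadlag T d) {B : ℝ} (hB : 0 ≤ B) :
    ∃ N, ∀ y₀, ∀ p ∈ YSet T d H L t₀ x₀ y₀ 0,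
      (N ≤ y₀ → B < p.2 T) ∧ (y₀ ≤ -N → p.2 T < -B) := by
  obtain ⟨R, _, hR, hRK⟩ := exists_lipschitz_bound hL ht₀ hx₀
  have hCH := hS.bound.1
  set C := CH * (1 + R)
  have hC : 0 ≤ C := by positivity
  refine ⟨growthConst C (T - t₀) * (1 + B), ?_⟩
  set N := growthConst C (T - t₀) * (1 + B)
  rintro y₀ ⟨x, y⟩ ⟨hx, hpre, hyc, g, hg, hint, hy⟩
  dsimp only at hx hpre hyc hg hint hy ⊢
  have hxR := (hRK x ⟨hx, hpre, g, hg⟩).1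
  have hT : T ∈ Icc t₀ T := right_mem_Icc.2 ht₀.2.le
  have hy0 : y t₀ = y₀ := by simpa using hy t₀ (left_mem_Icc.2 ht₀.2.le)
  have hNB : B < N := by
    have := le_mul_of_one_le_left (by positivity : 0 ≤ 1 + B) (one_le_growthConst C (T - t₀))
    linarith
  have hback : ∀ τ ∈ Icc t₀ T, |y τ| ≤ B → |y₀| < N := by
    intro τ hτ hyτ
    have hmaps : MapsTo (fun s => τ - s) (Icc 0 (τ - t₀)) (Icc t₀ T) := fun s hs =>
      ⟨by linarith [hs.2], by linarith [hs.1, hτ.2]⟩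
    have h1 := one_add_norm_le_growthConst (f := fun s => y (τ - s)) (a := 0) (b := τ - t₀) hC
      (hyc.comp (by fun_prop) hmaps) ?_ (τ - t₀) ⟨sub_nonneg.2 hτ.1, le_rfl⟩
    · simp only [sub_sub_cancel, sub_zero, hy0, Real.norm_eq_abs] at h1
      have h2 : growthConst C (τ - t₀) * (1 + |y τ|) ≤ N :=
        mul_le_mul (growthConst_mono hC (by linarith [hτ.2])) (by linarith) (by positivity)
          (zero_le_one.trans (one_le_growthConst _ _))
      linarith
    · intro s t hs hst ht Q hQ
      have hQ0 : 0 ≤ Q := (norm_nonneg _).trans (hQ t ⟨hs.trans hst, le_rfl⟩)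
      rw [norm_sub_rev]
      refine (norm_sub_le_of_primitive (K := C * (1 + Q)) hint hy (by linarith) (by linarith)
        (by linarith [hτ.2]) ?_).trans_eq (by ring)
      filter_upwards [ae_restrict_mem measurableSet_Ioo,
        ae_restrict_Ioo_mono (by linarith [ht₀.1]) (by linarith [hτ.2]) hS.bound.2] with r hr h3
      have hyr : |y r| ≤ Q := by
        have := hQ (τ - r) ⟨by linarith [hr.2], by linarith [hr.1]⟩
        simpa using this
      have hxr : runSup d x r ≤ R := runSup_le hR fun q hq =>
        hxR q ⟨hq.1, by linarith [hq.2, hr.2, hτ.2]⟩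
      rw [inner_zero_right, zero_sub, norm_neg]
      have h4 : 0 ≤ R * Q := by positivity
      have h5 : 1 + runSup d x r + |y r| ≤ (1 + R) * (1 + Q) := by linarith
      calc ‖H r x (y r) 0‖ ≤ CH * (1 + runSup d x r + |y r|) := h3 x hx (y r)
        _ ≤ CH * ((1 + R) * (1 + Q)) := by gcongr
        _ = C * (1 + Q) := by ring
  constructor
  · intro hN
    by_contra! hle
    obtain ⟨τ, hτ, hyτ⟩ := intermediate_value_Icc' ht₀.2.le hyc ⟨hle, by rw [hy0]; linarith⟩
    have := hback τ hτ (by rw [hyτ, abs_of_nonneg hB])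
    linarith [le_abs_self y₀]
  · intro hN
    by_contra! hle
    obtain ⟨τ, hτ, hyτ⟩ := intermediate_value_Icc ht₀.2.le hyc ⟨by rw [hy0]; linarith, hle⟩
    have := hback τ hτ (by rw [hyτ, abs_neg, abs_of_nonneg hB])
    linarith [neg_le_abs y₀]

end Bounds

section Perron

variable {T : ℝ} {d : ℕ} {H : Ham d} {h : Path d → ℝ} {LH CH : ℝ} {M : ℝ → ℝ}

/-- The upper value `sup {u(T₀, x) - y(T₀) : (x, y) ∈ Y^L(t, x, r, z)}`. -/
def upperValue (T : ℝ) (d : ℕ) (H : Ham d) (L : ℝ) (u : ℝ → Path d → EReal) (T₀ : ℝ) (z : E d)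
    (t : ℝ) (x : Path d) (r : ℝ) : EReal :=
  sSup ((fun p : Path d × (ℝ → ℝ) => u T₀ p.1 - ((p.2 T₀ : ℝ) : EReal)) '' YSet T d H L t x r z)

/-- The largest level with non-negative upper value. -/
def criticalLevel (T : ℝ) (d : ℕ) (H : Ham d) (L : ℝ) (u : ℝ → Path d → EReal) (T₀ : ℝ) (z : E d)
    (t : ℝ) (x : Path d) : EReal :=
  sSup {v : EReal | ∃ r : ℝ, v = (r : EReal) ∧ 0 ≤ upperValue T d H L u T₀ z t x r}

/-- The function `u`, replaced by the critical level before time `T₀`. -/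
def improve (T : ℝ) (d : ℕ) (H : Ham d) (L : ℝ) (u : ℝ → Path d → EReal) (T₀ : ℝ) (z : E d)
    (t : ℝ) (x : Path d) : EReal :=
  if t < T₀ then criticalLevel T d H L u T₀ z t x else u t x

variable {u : ℝ → Path d → EReal} {T₀ : ℝ} {z : E d}

lemma sub_le_upperValue {L t : ℝ} {x : Path d} {r : ℝ} {p : Path d × (ℝ → ℝ)}
    (hp : p ∈ YSet T d H L t x r z) :
    u T₀ p.1 - ((p.2 T₀ : ℝ) : EReal) ≤ upperValue T d H L u T₀ z t x r :=
  le_sSup (mem_image_of_mem _ hp)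

lemma lt_of_sub_coe_neg {a : EReal} {c : ℝ} (h : a - (c : EReal) < 0) : a < c :=
  (EReal.sub_neg (Or.inr (EReal.coe_ne_top c)) (Or.inr (EReal.coe_ne_bot c))).1 h

lemma upperValue_anti (hS : Standing T d H LH CH M) {L : ℝ} (hL : 0 ≤ L) {t : ℝ}
    (ht : t ∈ Ico 0 T) (hT₀ : T₀ ∈ Icc t T) {x : Path d} {c r : ℝ} (hc : c ≤ r) :
    upperValue T d H L u T₀ z t x r ≤ upperValue T d H L u T₀ z t x c := by
  refine sSup_le ?_
  rintro _ ⟨p, hp, rfl⟩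
  obtain ⟨q, hq, hqp, hle⟩ := exists_lower_characteristic hS hL ht hp hc
  refine le_trans ?_ (sub_le_upperValue hq)
  rw [hqp]
  exact EReal.sub_le_sub le_rfl (EReal.coe_le_coe_iff.2 (hle T₀ hT₀))

lemma upperValue_neg_of_criticalLevel_lt {L t : ℝ} {x : Path d} {r : ℝ}
    (hr : criticalLevel T d H L u T₀ z t x < (r : EReal)) :
    upperValue T d H L u T₀ z t x r < 0 := by
  by_contra! hle
  exact hr.not_ge (le_sSup ⟨r, rfl, hle⟩)

lemma criticalLevel_le (hS : Standing T d H LH CH M) {L : ℝ} (hL : 0 ≤ L) {t : ℝ}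
    (ht : t ∈ Ico 0 T) (hT₀ : T₀ ∈ Icc t T) {x : Path d} {r : ℝ}
    (hr : upperValue T d H L u T₀ z t x r < 0) :
    criticalLevel T d H L u T₀ z t x ≤ (r : EReal) := by
  refine sSup_le ?_
  rintro _ ⟨r', rfl, h0⟩
  by_contra! hlt
  exact (h0.trans (upperValue_anti hS hL ht hT₀ (EReal.coe_lt_coe_iff.1 hlt).le)).not_gt hr

lemma upperValue_le_of_mem (hS : Standing T d H LH CH M) {L : ℝ} (hL : 0 ≤ L) {t₀ s : ℝ}
    (ht₀ : t₀ ∈ Ico 0 T) (hs : s ∈ Icc t₀ T) (hT₀ : s < T₀) {x₀ : Path d}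
    (hx₀ : x₀ ∈ Cadlag T d) {y₀ : ℝ} {p : Path d × (ℝ → ℝ)}
    (hp : p ∈ YSet T d H L t₀ x₀ y₀ z) :
    upperValue T d H L u T₀ z s p.1 (p.2 s) ≤ upperValue T d H L u T₀ z t₀ x₀ y₀ := by
  refine sSup_le ?_
  rintro _ ⟨q, hq, rfl⟩
  simpa only [if_neg hT₀.not_ge] using
    sub_le_upperValue (u := u) (T₀ := T₀) (concat_mem_ySet hS hL ht₀ hs hx₀ hp hq)

lemma sInf_ySet_le_of_mem (hS : Standing T d H LH CH M) {L : ℝ} (hL : 0 ≤ L) {t₀ s : ℝ}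
    (ht₀ : t₀ ∈ Ico 0 T) (hs : s ∈ Icc t₀ T) (hT₀ : s < T₀) {x₀ : Path d}
    (hx₀ : x₀ ∈ Cadlag T d) {y₀ : ℝ} {p : Path d × (ℝ → ℝ)}
    (hp : p ∈ YSet T d H L t₀ x₀ y₀ z) :
    sInf ((fun p : Path d × (ℝ → ℝ) => u T₀ p.1 - ((p.2 T₀ : ℝ) : EReal)) ''
        YSet T d H L t₀ x₀ y₀ z) ≤
      sInf ((fun p : Path d × (ℝ → ℝ) => u T₀ p.1 - ((p.2 T₀ : ℝ) : EReal)) ''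
        YSet T d H L s p.1 (p.2 s) z) := by
  refine le_sInf ?_
  rintro _ ⟨q, hq, rfl⟩
  exact sInf_le ⟨_, concat_mem_ySet hS hL ht₀ hs hx₀ hp hq, by simp only [if_neg hT₀.not_ge]⟩

theorem NCSuper.improve (hS : Standing T d H LH CH M) (hu : NCSuper T d H h LH u)
    (hT₀ : T₀ ≤ T) (z : E d) : NCSuper T d H h LH (improve T d H LH u T₀ z) := by
  have hLH := hS.lipZ.1
  refine ⟨fun x hx => by rw [PHJ.improve, if_neg hT₀.not_gt, hu.1 x hx], ?_⟩
  intro t₀ ht₀ x₀ hx₀ z' y₀ hy₀ T₁ hT₁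
  rcases le_or_gt T₀ t₀ with hle | hlt
  · simp only [PHJ.improve, if_neg hle.not_gt] at hy₀
    simp only [PHJ.improve, if_neg (hle.trans hT₁.1.le).not_gt]
    exact hu.2 t₀ ht₀ x₀ hx₀ z' y₀ hy₀ T₁ hT₁
  simp only [PHJ.improve, if_pos hlt] at hy₀
  have hneg := upperValue_neg_of_criticalLevel_lt hy₀
  obtain ⟨p, hp, hp'⟩ := exists_common_characteristic hS ht₀ hx₀ y₀ z z'
  have hpT₀ : u T₀ p.1 < ((p.2 T₀ : ℝ) : EReal) :=
    lt_of_sub_coe_neg ((sub_le_upperValue hp).trans_lt hneg)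
  rcases lt_trichotomy T₁ T₀ with h1 | rfl | h1
  · refine sInf_le_of_le ⟨p, hp', rfl⟩ (EReal.sub_nonpos.2 ?_)
    simp only [PHJ.improve, if_pos h1]
    exact criticalLevel_le hS hLH ⟨ht₀.1.trans hT₁.1.le, h1.trans_le hT₀⟩ ⟨h1.le, hT₀⟩
      ((upperValue_le_of_mem hS hLH ht₀ ⟨hT₁.1.le, hT₁.2⟩ h1 hx₀ hp).trans_lt hneg)
  · refine sInf_le_of_le ⟨p, hp', rfl⟩ (EReal.sub_nonpos.2 ?_)
    simpa only [PHJ.improve, if_neg (lt_irrefl T₁)] using hpT₀.le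
  · simp only [PHJ.improve, if_neg h1.not_gt]
    exact (sInf_ySet_le_of_mem hS hLH ht₀ ⟨hlt.le, hT₀⟩ h1 hx₀ hp').trans
      (hu.2 T₀ ⟨ht₀.1.trans hlt.le, h1.trans_le hT₁.2⟩ p.1 hp.1 z' (p.2 T₀) hpT₀ T₁ ⟨h1, hT₁.2⟩)

lemma exists_ncSuper (T : ℝ) (d : ℕ) (H : Ham d) (h : Path d → ℝ) (L : ℝ) :
    ∃ u, NCSuper T d H h L u := by
  refine ⟨fun t x => if t = T then ((h x : ℝ) : EReal) else ⊤, fun x _ => if_pos rfl, ?_⟩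
  intro t₀ ht₀ x₀ _ z y₀ hy₀
  simp only [if_neg ht₀.2.ne] at hy₀
  exact absurd hy₀ not_top_lt

lemma uZero_le {L : ℝ} (hu : NCSuper T d H h L u) (t : ℝ) (x : Path d) :
    uZero T d H h L t x ≤ u t x :=
  sInf_le ⟨u, hu, rfl⟩

lemma uZero_terminal (L : ℝ) {x : Path d} (hx : x ∈ Cadlag T d) :
    uZero T d H h L T x = ((h x : ℝ) : EReal) := by
  obtain ⟨u, hu⟩ := exists_ncSuper T d H h L
  refine le_antisymm ((uZero_le hu T x).trans_eq (hu.1 x hx)) (le_sInf ?_)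
  rintro _ ⟨v, hv, rfl⟩
  exact (hv.1 x hx).ge

theorem ncSuper_uZero (T : ℝ) (d : ℕ) (H : Ham d) (h : Path d → ℝ) (L : ℝ) :
    NCSuper T d H h L (uZero T d H h L) := by
  refine ⟨fun x hx => uZero_terminal L hx, fun t₀ ht₀ x₀ hx₀ z y₀ hy₀ T₀ hT₀ => ?_⟩
  obtain ⟨_, ⟨u, hu, rfl⟩, hlt⟩ := sInf_lt_iff.1 hy₀
  refine le_trans (le_sInf ?_) (hu.2 t₀ ht₀ x₀ hx₀ z y₀ hlt T₀ hT₀)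
  rintro _ ⟨p, hp, rfl⟩
  exact sInf_le_of_le ⟨p, hp, rfl⟩ (EReal.sub_le_sub (uZero_le hu _ _) le_rfl)

theorem ncSub_uZero (hS : Standing T d H LH CH M) (h : Path d → ℝ) :
    NCSub T d H h LH (uZero T d H h LH) := by
  refine ⟨fun x hx => uZero_terminal LH hx, fun t₀ ht₀ x₀ hx₀ z y₀ hy₀ T₀ hT₀ => ?_⟩
  by_contra! hneg
  refine hy₀.not_ge ?_
  calc uZero T d H h LH t₀ x₀
      ≤ improve T d H LH (uZero T d H h LH) T₀ z t₀ x₀ :=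
        uZero_le ((ncSuper_uZero T d H h LH).improve hS hT₀.2 z) t₀ x₀
    _ = criticalLevel T d H LH (uZero T d H h LH) T₀ z t₀ x₀ := if_pos hT₀.1
    _ ≤ y₀ := criticalLevel_le hS hS.lipZ.1 ht₀ ⟨hT₀.1.le, hT₀.2⟩ hneg

lemma YSet.fst_mem {L t₀ : ℝ} {x₀ : Path d} {y₀ : ℝ} {p : Path d × (ℝ → ℝ)}
    (hp : p ∈ YSet T d H L t₀ x₀ y₀ z) : p.1 ∈ XSet T d L t₀ x₀ :=
  ⟨hp.1, hp.2.1, hp.2.2.2.imp fun _ hg => hg.1⟩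

theorem uZero_finite (hS : Standing T d H LH CH M) (hh : TermCont T d h) {t₀ : ℝ}
    (ht₀ : t₀ ∈ Icc 0 T) {x₀ : Path d} (hx₀ : x₀ ∈ Cadlag T d) :
    uZero T d H h LH t₀ x₀ ≠ ⊤ ∧ uZero T d H h LH t₀ x₀ ≠ ⊥ := by
  rcases ht₀.2.eq_or_lt with rfl | hlt
  · rw [uZero_terminal LH hx₀]
    exact ⟨EReal.coe_ne_top _, EReal.coe_ne_bot _⟩
  replace ht₀ : t₀ ∈ Ico 0 T := ⟨ht₀.1, hlt⟩
  have hLH := hS.lipZ.1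
  obtain ⟨B, hB⟩ := exists_bound_termCond hh hLH ht₀ hx₀
  have hB0 : 0 ≤ |B| + 1 := by positivity
  obtain ⟨N, hN⟩ := exists_large hS hLH ht₀ hx₀ hB0
  set u₀ := uZero T d H h LH
  have hu₀ : NCSuper T d H h LH u₀ := ncSuper_uZero T d H h LH
  have hval : ∀ p ∈ YSet T d H LH t₀ x₀ N 0, u₀ T p.1 - ((p.2 T : ℝ) : EReal) ≤ ((-1 : ℝ) : EReal) := by
    intro p hp
    have h1 := (abs_le.1 (hB p.1 (YSet.fst_mem hp))).2
    have h2 := (hN N p hp).1 le_rfl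
    rw [hu₀.1 p.1 hp.1, ← EReal.coe_sub, EReal.coe_le_coe_iff]
    linarith [le_abs_self B]
  have hval' : ∀ p ∈ YSet T d H LH t₀ x₀ (-N) 0,
      ((1 : ℝ) : EReal) ≤ u₀ T p.1 - ((p.2 T : ℝ) : EReal) := by
    intro p hp
    have h1 := (abs_le.1 (hB p.1 (YSet.fst_mem hp))).1
    have h2 := (hN (-N) p hp).2 le_rfl
    rw [hu₀.1 p.1 hp.1, ← EReal.coe_sub, EReal.coe_le_coe_iff]
    linarith [le_abs_self B]
  constructor
  · have hneg : upperValue T d H LH u₀ T 0 t₀ x₀ N < 0 := by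
      refine lt_of_le_of_lt (sSup_le ?_) (EReal.coe_lt_coe_iff.2 neg_one_lt_zero)
      rintro _ ⟨p, hp, rfl⟩
      exact hval p hp
    have h1 : u₀ t₀ x₀ ≤ (N : EReal) :=
      calc u₀ t₀ x₀ ≤ improve T d H LH u₀ T 0 t₀ x₀ := uZero_le (hu₀.improve hS le_rfl 0) t₀ x₀
        _ = criticalLevel T d H LH u₀ T 0 t₀ x₀ := if_pos hlt
        _ ≤ N := criticalLevel_le hS hLH ht₀ ⟨hlt.le, le_rfl⟩ hneg
    exact (h1.trans_lt (EReal.coe_lt_top N)).ne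
  · intro hbot
    have h1 := hu₀.2 t₀ ht₀ x₀ hx₀ 0 (-N) (by rw [hbot]; exact EReal.bot_lt_coe _) T ⟨hlt, le_rfl⟩
    have h2 : ((1 : ℝ) : EReal) ≤ 0 := by
      refine le_trans (le_sInf ?_) h1
      rintro _ ⟨p, hp, rfl⟩
      exact hval' p hp
    exact absurd (EReal.coe_le_coe_iff.1 h2) (by norm_num)

end Perron

/-- The pointwise infimum `u₀` of all non-continuous minimax
`L_H`-supersolutions of (TVP) is a non-continuous minimax `L_H`-solution of (TVP) and
is real-valued. -/
theorem uZero_NCSolution (T : ℝ) (hT : 0 < T) (d : ℕ) (hd : 1 ≤ d)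
    (H : Ham d) (LH CH : ℝ) (M : ℝ → ℝ)
    (hH1 : HamCont T d H) (hH2 : HamMeas d H) (hH3 : HamLipZ T d H LH)
    (hH4 : HamLipX T d H M) (hH5 : HamMono T d H) (hH6 : HamBound T d H CH)
    (h : Path d → ℝ) (hh : TermCont T d h) :
    NCSuper T d H h LH (uZero T d H h LH) ∧ NCSub T d H h LH (uZero T d H h LH) ∧
    ∀ t ∈ Icc (0 : ℝ) T, ∀ x ∈ Cadlag T d,
      uZero T d H h LH t x ≠ ⊤ ∧ uZero T d H h LH t x ≠ ⊥ := by
  have hS : Standing T d H LH CH M := ⟨hH1, hH2, hH3, hH4, hH5, hH6⟩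
  exact ⟨ncSuper_uZero T d H h LH, ncSub_uZero hS h, fun _ ht _ hx => uZero_finite hS hh ht hx⟩

end PHJ
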